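/- arXiv:1912.08982 — 2 statements merged into one kernel-verified Lean document; each statement's English description precedes it below -/
import Mathlib

section
/- Let C̃ be an S-complex over a commutative ring R, with large equivariant 'hat' complex (Ĉ_*, d̂) and small equivariant complex (𝔣Ĉ_*, 𝔡̂). Define Φ̂: Ĉ_* → 𝔣Ĉ_* by Φ̂(Σ_{i=0}^N αᵢxⁱ, Σ_{i=0}^N βᵢxⁱ, Σ_{i=0}^N aᵢxⁱ) = (Σ_{i=0}^N vⁱ(βᵢ), Σ_{i=0}^N aᵢxⁱ + Σ_{i=1}^N Σ_{j=0}^{i−1} δ₁vʲ(βᵢ) x^{i−j−1}) and Ψ̂: 𝔣Ĉ_* → Ĉ_* by Ψ̂(α, Σ_{i=0}^N aᵢxⁱ) = (Σ_{i=1}^N Σ_{j=0}^{i−1} vʲδ₂(aᵢ) x^{i−j−1}, α, Σ_{i=0}^N aᵢxⁱ). Then Φ̂ and Ψ̂ are chain maps, Φ̂ commutes with the action of x, Ψ̂ commutes with the action of x up to chain homotopy, Φ̂ ∘ Ψ̂ = id, and Ψ̂ ∘ Φ̂ is chain homotopic to the identity via the homotopy K̂(Σ_{i=0}^N αᵢxⁱ,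 Σ_{i=0}^N βᵢxⁱ, Σ_{i=0}^N aᵢxⁱ) = (−Σ_{i=1}^N Σ_{j=0}^{i−1} vʲ(βᵢ) x^{i−j−1}, 0, 0), i.e. Ψ̂ ∘ Φ̂ − id = d̂ ∘ K̂ + K̂ ∘ d̂. -/
/-!  S-complexes over a commutative ring `R` (following Daemi–Scaduto).

An S-complex is a ℤ-graded finitely generated free chain complex
`C̃ = C ⊕ C[1] ⊕ R` determined by the data of `C` together with maps
`d, v, δ₁, δ₂`.  We encode the graded module `C` by a single module `Tot`
together with an internal ℤ-grading by submodules, and we carry the sign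
map `ε` (multiplication by `(-1)^i` on the degree `i` part) as data. -/

universe u

/-- The data of an S-complex over `R`: a module `Tot` (the total module of the
ℤ-graded module `C_*`), its grading, the sign map `ε`, and the structure maps
`d : C_* → C_{*-1}`, `v : C_* → C_{*-2}`, `δ₁ : C_* → R` (supported in degree 1),
`δ₂ : R → C_{-2}`. -/
structure SComplexData (R : Type u) [CommRing R] where
  Tot : Type u
  [acg : AddCommGroup Tot]
  [mod : Module R Tot]
  grading : ℤ → Submodule R Tot
  sign : Tot →ₗ[R] Tot
  d : Tot →ₗ[R] Tot
  v : Tot →ₗ[R] Tot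
  δ₁ : Tot →ₗ[R] R
  δ₂ : R →ₗ[R] Tot

attribute [instance] SComplexData.acg SComplexData.mod

namespace SComplexData

variable {R : Type u} [CommRing R]

/-- The axioms making the data of `X : SComplexData R` into a genuine S-complex:
the grading is an internal direct sum decomposition into finitely generated free
pieces, the sign map is `(-1)^i` on the degree `i` piece, the structure maps are
graded of the appropriate degrees (`δ₁` supported on `C_1`, `δ₂` valued in `C_{-2}`),
and the S-complex relations `d∘d = 0`, `δ₁∘d = 0`, `d∘δ₂ = 0`,
`d∘v − v∘d − δ₂∘δ₁ = 0` hold; the latter are equivalent to `d̃ ∘ d̃ = 0` for the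
differential `d̃(α, β, r) = (dα, vα − dβ + δ₂ r, δ₁ α)` on `C̃ = C ⊕ C[1] ⊕ R`. -/
structure IsSComplex (X : SComplexData R) : Prop where
  internal : DirectSum.IsInternal X.grading
  free : ∀ i : ℤ, Module.Free R ↥(X.grading i)
  finite : Module.Finite R X.Tot
  sign_spec : ∀ i : ℤ, ∀ x ∈ X.grading i, X.sign x = if Even i then x else -x
  d_deg : ∀ i : ℤ, (X.grading i).map X.d ≤ X.grading (i - 1)
  v_deg : ∀ i : ℤ, (X.grading i).map X.v ≤ X.grading (i - 2)
  δ₁_deg : ∀ i : ℤ, i ≠ 1 → ∀ x ∈ X.grading i, X.δ₁ x = 0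
  δ₂_deg : LinearMap.range X.δ₂ ≤ X.grading (-2)
  d_d : X.d ∘ₗ X.d = 0
  δ₁_d : X.δ₁ ∘ₗ X.d = 0
  d_δ₂ : X.d ∘ₗ X.δ₂ = 0
  d_v : X.d ∘ₗ X.v - X.v ∘ₗ X.d - X.δ₂ ∘ₗ X.δ₁ = 0

/-- A morphism of S-complexes `λ̃ : C̃ → C̃'`, i.e. a degree-0 chain map
`λ̃(α, β, r) = (λ α, μ α + λ β + Δ₂ r, Δ₁ α + r)`, recorded through its
components `λ, μ, Δ₁, Δ₂` (here `l` stands for `λ`). -/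
structure SMorphism (X Y : SComplexData R) where
  l : X.Tot →ₗ[R] Y.Tot
  μ : X.Tot →ₗ[R] Y.Tot
  Δ₁ : X.Tot →ₗ[R] R
  Δ₂ : R →ₗ[R] Y.Tot
  l_deg : ∀ i : ℤ, (X.grading i).map l ≤ Y.grading i
  μ_deg : ∀ i : ℤ, (X.grading i).map μ ≤ Y.grading (i - 1)
  Δ₁_deg : ∀ i : ℤ, i ≠ 0 → ∀ x ∈ X.grading i, Δ₁ x = 0
  Δ₂_deg : LinearMap.range Δ₂ ≤ Y.grading (-1)
  comm_d : l ∘ₗ X.d = Y.d ∘ₗ l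
  comm_δ₁ : Δ₁ ∘ₗ X.d + X.δ₁ = Y.δ₁ ∘ₗ l
  comm_δ₂ : Y.d ∘ₗ Δ₂ + l ∘ₗ X.δ₂ = Y.δ₂
  comm_v : μ ∘ₗ X.d + Y.d ∘ₗ μ + l ∘ₗ X.v - Y.v ∘ₗ l + Δ₂ ∘ₗ X.δ₁ - Y.δ₂ ∘ₗ Δ₁ = 0

end SComplexData

/-- Functions `ℕ → M` with finitely many nonzero values (i.e. support bounded
above); this realizes the polynomial module `M[x]`. -/
def NatBdd (R : Type u) [CommRing R] (M : Type u) [AddCommGroup M] [Module R M] :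
    Submodule R (ℕ → M) where
  carrier := {f | ∃ N : ℕ, ∀ n : ℕ, N < n → f n = 0}
  add_mem' := by
    rintro f g ⟨N, hN⟩ ⟨K, hK⟩
    refine ⟨max N K, fun n hn => ?_⟩
    have h1 := hN n (lt_of_le_of_lt (le_max_left N K) hn)
    have h2 := hK n (lt_of_le_of_lt (le_max_right N K) hn)
    show f n + g n = 0
    rw [h1, h2, add_zero]
  zero_mem' := ⟨0, fun _ _ => rfl⟩
  smul_mem' := by
    rintro c f ⟨N, hN⟩
    refine ⟨N, fun n hn => ?_⟩
    show c • f n = 0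
    rw [hN n hn, smul_zero]

/-- Functions `ℤ → M` with support bounded above; for `M = R` this realizes the
ring `R[[x⁻¹, x]]` of Laurent series with finitely many positive powers of `x`. -/
def IntBdd (R : Type u) [CommRing R] (M : Type u) [AddCommGroup M] [Module R M] :
    Submodule R (ℤ → M) where
  carrier := {f | ∃ N : ℤ, ∀ n : ℤ, N < n → f n = 0}
  add_mem' := by
    rintro f g ⟨N, hN⟩ ⟨K, hK⟩
    refine ⟨max N K, fun n hn => ?_⟩
    have h1 := hN n (lt_of_le_of_lt (le_max_left N K) hn)
    have h2 := hK n (lt_of_le_of_lt (le_max_right N K) hn)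
    show f n + g n = 0
    rw [h1, h2, add_zero]
  zero_mem' := ⟨0, fun _ _ => rfl⟩
  smul_mem' := by
    rintro c f ⟨N, hN⟩
    refine ⟨N, fun n hn => ?_⟩
    show c • f n = 0
    rw [hN n hn, smul_zero]

/-- The multiplication of `R[[x⁻¹, x]]`, realized as a convolution product on
functions `ℤ → R` with support bounded above. -/
noncomputable def lmul {R : Type u} [CommRing R] (f g : ↥(IntBdd R R)) : ↥(IntBdd R R) :=
  ⟨fun n => ∑ᶠ i : ℤ, f.1 i * g.1 (n - i), by
    obtain ⟨N, hN⟩ := f.2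
    obtain ⟨K, hK⟩ := g.2
    refine ⟨N + K, fun n hn => ?_⟩
    apply finsum_eq_zero_of_forall_eq_zero
    intro i
    by_cases h : N < i
    · rw [hN i h, zero_mul]
    · rw [hK (n - i) (by omega), mul_zero]⟩

namespace SComplexData

variable {R : Type u} [CommRing R]

/-- The carrier of the small equivariant complex `𝔣Ĉ_* = C_{*-1} ⊕ R[x]`,
with `R[x]` realized as finitely supported functions `ℕ → R`. -/
abbrev Small (X : SComplexData R) : Type u := X.Tot × ↥(NatBdd R R)

/-- `Σᵢ vⁱ δ₂(aᵢ)` for a polynomial with coefficients `aᵢ`. -/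
noncomputable def sumV (X : SComplexData R) (f : ↥(NatBdd R R)) : X.Tot :=
  ∑ᶠ i : ℕ, (X.v ^ i) (X.δ₂ (f.1 i))

/-- The differential `𝔡̂(α, Σᵢ aᵢxⁱ) = (dα − Σᵢ vⁱδ₂(aᵢ), 0)` of the small
equivariant complex. -/
noncomputable def smallD (X : SComplexData R) : X.Small → X.Small :=
  fun z => (X.d z.1 - X.sumV z.2, 0)

/-- The `R[x]`-module structure of the small equivariant complex:
`x · (α, p(x)) = (v(α), δ₁(α) + x·p(x))`; this is the action of `x`. -/
noncomputable def xSmall (X : SComplexData R) : X.Small → X.Small :=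
  fun z => (X.v z.1, ⟨fun n => if n = 0 then X.δ₁ z.1 else z.2.1 (n - 1), by
    obtain ⟨N, hN⟩ := z.2.2
    refine ⟨N + 1, fun n hn => ?_⟩
    show (if n = 0 then X.δ₁ z.1 else z.2.1 (n - 1)) = 0
    rw [if_neg (by omega)]
    exact hN (n - 1) (by omega)⟩)

/-- The map `𝔦 : 𝔣Ĉ_* → R[[x⁻¹, x]]`,
`𝔦(α, Σᵢ aᵢxⁱ) = Σ_{i ≤ −1} δ₁v^{−i−1}(α) xⁱ + Σᵢ aᵢxⁱ`. -/
noncomputable def iota (X : SComplexData R) : X.Small → ↥(IntBdd R R) :=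
  fun z => ⟨fun n => if n < 0 then X.δ₁ ((X.v ^ (-n - 1).toNat) z.1) else z.2.1 n.toNat, by
    obtain ⟨N, hN⟩ := z.2.2
    refine ⟨(N : ℤ), fun n hn => ?_⟩
    show (if n < 0 then X.δ₁ ((X.v ^ (-n - 1).toNat) z.1) else z.2.1 n.toNat) = 0
    rw [if_neg (by omega)]
    exact hN n.toNat (by omega)⟩

/-- `𝔍(C̃) = 𝔦(ker 𝔡̂)`, an `R[x]`-submodule of `R[[x⁻¹, x]]`, here recorded
as a set. -/
noncomputable def JJ (X : SComplexData R) : Set ↥(IntBdd R R) :=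
  X.iota '' {z | X.smallD z = 0}

/-- `DegEq Q n` means that the Laurent series `Q` is nonzero with `Deg Q = n`,
i.e. `n` is the largest exponent with nonzero coefficient. -/
def DegEq {R : Type u} [CommRing R] (Q : ↥(IntBdd R R)) (n : ℤ) : Prop :=
  Q.1 n ≠ 0 ∧ ∀ m : ℤ, n < m → Q.1 m = 0

/-- The set of degrees of nonzero elements of `𝔍(C̃)`. -/
noncomputable def degSet (X : SComplexData R) : Set ℤ :=
  {n : ℤ | ∃ Q ∈ X.JJ, DegEq Q n}

/-- The Frøyshov invariant `h(C̃) = −inf {Deg Q : 0 ≠ Q ∈ 𝔍(C̃)}`. -/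
noncomputable def hInv (X : SComplexData R) : ℤ := -sInf X.degSet

/-- The ideal `J_i(C̃) = {a ∈ R : ∃ Q = a·x^{−i} + (lower order terms) ∈ 𝔍(C̃)}`,
recorded as a set. -/
noncomputable def Jideal (X : SComplexData R) (i : ℤ) : Set R :=
  {a : R | ∃ Q ∈ X.JJ, (∀ m : ℤ, -i < m → Q.1 m = 0) ∧ Q.1 (-i) = a}

end SComplexData

namespace SComplexData

variable {R : Type u} [CommRing R]

/-- The module underlying the full complex `C̃ = C ⊕ C[1] ⊕ R`. -/
abbrev Ct (X : SComplexData R) : Type u := X.Tot × X.Tot × R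

/-- The differential `d̃(α, β, r) = (dα, vα − dβ + δ₂ r, δ₁ α)` of `C̃`. -/
noncomputable def dTilde (X : SComplexData R) : X.Ct → X.Ct :=
  fun z => (X.d z.1, X.v z.1 - X.d z.2.1 + X.δ₂ z.2.2, X.δ₁ z.1)

/-- The map `χ(α, β, r) = (0, α, 0)` on `C̃`. -/
noncomputable def chiT (X : SComplexData R) : X.Ct → X.Ct :=
  fun z => (0, z.1, 0)

/-- The chain-level map `C̃ → C̃'`, `(α, β, r) ↦ (λα, μα + λβ + Δ₂ r, Δ₁ α + r)`,
induced by a morphism of S-complexes. -/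
noncomputable def mTilde {A B : SComplexData R} (f : SMorphism A B) : A.Ct → B.Ct :=
  fun z => (f.l z.1, f.μ z.1 + f.l z.2.1 + f.Δ₂ z.2.2, f.Δ₁ z.1 + z.2.2)

end SComplexData

namespace SComplexData

variable {R : Type u} [CommRing R]

/-- The carrier of the large equivariant complex `Ĉ_* = R[x] ⊗ C̃_*`, realized
as finitely supported functions `ℕ → C̃` (coefficients of powers of `x`). -/
abbrev Hat (X : SComplexData R) : Type u := ↥(NatBdd R X.Ct)

/-- The differential `d̂(xⁱ·ζ) = −xⁱ·d̃ζ + x^{i+1}·χ(ζ)` of the large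
equivariant complex `Ĉ`. -/
noncomputable def hatD (X : SComplexData R) : X.Hat → X.Hat := fun F =>
  ⟨fun n => -X.dTilde (F.1 n) + (if n = 0 then 0 else X.chiT (F.1 (n - 1))), by
    obtain ⟨N, hN⟩ := F.2
    refine ⟨N + 1, fun n hn => ?_⟩
    show -X.dTilde (F.1 n) + (if n = 0 then 0 else X.chiT (F.1 (n - 1))) = 0
    rw [if_neg (by omega), hN n (by omega), hN (n - 1) (by omega)]
    simp [dTilde, chiT]⟩

/-- The action of `x` on the large equivariant complex `Ĉ`. -/
noncomputable def xHat (X : SComplexData R) : X.Hat → X.Hat := fun F =>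
  ⟨fun n => if n = 0 then 0 else F.1 (n - 1), by
    obtain ⟨N, hN⟩ := F.2
    refine ⟨N + 1, fun n hn => ?_⟩
    show (if n = 0 then 0 else F.1 (n - 1)) = 0
    rw [if_neg (by omega)]
    exact hN (n - 1) (by omega)⟩

/-- The map `Φ̂ : Ĉ_* → 𝔣Ĉ_*`,
`Φ̂(Σαᵢxⁱ, Σβᵢxⁱ, Σaᵢxⁱ) = (Σᵢ vⁱ(βᵢ), Σᵢaᵢxⁱ + Σᵢ Σ_{j<i} δ₁vʲ(βᵢ) x^{i−j−1})`. -/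
noncomputable def phiHat (X : SComplexData R) : X.Hat → X.Small := fun F =>
  (∑ᶠ i : ℕ, (X.v ^ i) ((F.1 i).2.1),
   ⟨fun n => (F.1 n).2.2 + ∑ᶠ j : ℕ, X.δ₁ ((X.v ^ j) ((F.1 (n + j + 1)).2.1)), by
    obtain ⟨N, hN⟩ := F.2
    refine ⟨N, fun n hn => ?_⟩
    show (F.1 n).2.2 + (∑ᶠ j : ℕ, X.δ₁ ((X.v ^ j) ((F.1 (n + j + 1)).2.1))) = 0
    rw [hN n hn, finsum_eq_zero_of_forall_eq_zero
      (fun j => by rw [hN (n + j + 1) (by omega)]; simp)]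
    simp⟩)

/-- The map `Ψ̂ : 𝔣Ĉ_* → Ĉ_*`,
`Ψ̂(α, Σᵢaᵢxⁱ) = (Σᵢ Σ_{j<i} vʲδ₂(aᵢ) x^{i−j−1}, α, Σᵢaᵢxⁱ)`. -/
noncomputable def psiHat (X : SComplexData R) : X.Small → X.Hat := fun z =>
  ⟨fun n => (∑ᶠ j : ℕ, (X.v ^ j) (X.δ₂ (z.2.1 (n + j + 1))),
             if n = 0 then z.1 else 0, z.2.1 n), by
    obtain ⟨N, hN⟩ := z.2.2
    refine ⟨N, fun n hn => ?_⟩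
    show ((∑ᶠ j : ℕ, (X.v ^ j) (X.δ₂ (z.2.1 (n + j + 1)))),
          if n = 0 then z.1 else 0, z.2.1 n) = 0
    rw [if_neg (by omega), hN n hn, finsum_eq_zero_of_forall_eq_zero
      (fun j => by rw [hN (n + j + 1) (by omega)]; simp)]
    rfl⟩

/-- The chain homotopy `K̂(Σαᵢxⁱ, Σβᵢxⁱ, Σaᵢxⁱ) = (−Σᵢ Σ_{j<i} vʲ(βᵢ)x^{i−j−1}, 0, 0)`. -/
noncomputable def kHat (X : SComplexData R) : X.Hat → X.Hat := fun F =>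
  ⟨fun n => (-∑ᶠ j : ℕ, (X.v ^ j) ((F.1 (n + j + 1)).2.1), 0, 0), by
    obtain ⟨N, hN⟩ := F.2
    refine ⟨N, fun n hn => ?_⟩
    show (-∑ᶠ j : ℕ, (X.v ^ j) ((F.1 (n + j + 1)).2.1), (0 : X.Tot), (0 : R)) = 0
    rw [finsum_eq_zero_of_forall_eq_zero
      (fun j => by rw [hN (n + j + 1) (by omega)]; simp)]
    simp⟩

end SComplexData

/-- The tails `∑ⱼ vʲ(f (n + j))` of a finitely supported sequence `f`, which satisfy the
Horner recursion `horner_succ`. -/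
noncomputable def horner {R : Type u} [CommRing R] {M : Type u} [AddCommGroup M] [Module R M]
    (v : M →ₗ[R] M) (f : ℕ → M) (n : ℕ) : M :=
  ∑ᶠ j : ℕ, (v ^ j) (f (n + j))

section Horner

variable {R : Type u} [CommRing R] {M P : Type u} [AddCommGroup M] [Module R M]
  [AddCommGroup P] [Module R P]

theorem NatBdd.map_mem {f : ℕ → M} (hf : f ∈ NatBdd R M) (φ : M →ₗ[R] P) :
    (fun n => φ (f n)) ∈ NatBdd R P := by
  obtain ⟨N, hN⟩ := hf
  exact ⟨N, fun n hn => by simp [hN n hn]⟩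

theorem NatBdd.tail_mem {f : ℕ → M} (hf : f ∈ NatBdd R M) (k : ℕ) :
    (fun n => f (n + k)) ∈ NatBdd R M := by
  obtain ⟨N, hN⟩ := hf
  exact ⟨N, fun n hn => hN _ (by omega)⟩

theorem NatBdd.shift_mem {f : ℕ → M} (hf : f ∈ NatBdd R M) (a : M) :
    (fun n => if n = 0 then a else f (n - 1)) ∈ NatBdd R M := by
  obtain ⟨N, hN⟩ := hf
  exact ⟨N + 1, fun n hn => (if_neg (by omega)).trans (hN _ (by omega))⟩

theorem horner_mem (v : M →ₗ[R] M) {f : ℕ → M} (hf : f ∈ NatBdd R M) :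
    horner v f ∈ NatBdd R M := by
  obtain ⟨N, hN⟩ := hf
  exact ⟨N, fun n hn => finsum_eq_zero_of_forall_eq_zero
    fun j => by rw [hN _ (by omega), map_zero]⟩

theorem horner_support_finite (v : M →ₗ[R] M) {f : ℕ → M} (hf : f ∈ NatBdd R M) (n : ℕ) :
    (Function.support fun j => (v ^ j) (f (n + j))).Finite := by
  obtain ⟨N, hN⟩ := hf
  refine (Set.finite_Iic N).subset fun j hj => ?_
  by_contra h
  rw [Set.mem_Iic, not_le] at h
  exact hj (by simp [hN (n + j) (by omega)])

theorem map_horner (v : M →ₗ[R] M) {f : ℕ → M} (hf : f ∈ NatBdd R M) (φ : M →ₗ[R] P) (n : ℕ) :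
    φ (horner v f n) = ∑ᶠ j : ℕ, φ ((v ^ j) (f (n + j))) :=
  φ.toAddMonoidHom.map_finsum (horner_support_finite v hf n)

theorem map_horner_eq_zero (v : M →ₗ[R] M) {f : ℕ → M} (hf : f ∈ NatBdd R M) (φ : M →ₗ[R] P)
    (h : ∀ j n, φ ((v ^ j) (f n)) = 0) (n : ℕ) : φ (horner v f n) = 0 := by
  rw [map_horner v hf]
  exact finsum_eq_zero_of_forall_eq_zero fun j => h _ _

theorem horner_succ (v : M →ₗ[R] M) {f : ℕ → M} (hf : f ∈ NatBdd R M) (n : ℕ) :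
    horner v f n = f n + v (horner v f (n + 1)) := by
  obtain ⟨N, hN⟩ := id hf
  rw [map_horner v hf, horner,
    finsum_eq_sum_of_support_subset (s := Finset.range (N + 2)),
    finsum_eq_sum_of_support_subset (s := Finset.range (N + 1)), Finset.sum_range_succ', add_comm]
  · simp [pow_succ', add_assoc, add_comm 1]
  all_goals
    intro j hj
    by_contra h
    rw [Finset.coe_range, Set.mem_Iio, not_lt] at h
    refine hj ?_
    beta_reduce
    rw [hN _ (by omega)]
    simp only [map_zero]

theorem eq_horner (v : M →ₗ[R] M) {f g : ℕ → M} (hf : f ∈ NatBdd R M) (hg : g ∈ NatBdd R M)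
    (h : ∀ n, g n = f n + v (g (n + 1))) (n : ℕ) : horner v f n = g n := by
  obtain ⟨N, hN⟩ := Submodule.sub_mem _ (horner_mem v hf) hg
  have key : ∀ k n, N < n + k → horner v f n = g n := by
    intro k
    induction k with
    | zero => exact fun n hn => sub_eq_zero.mp (hN n hn)
    | succ k ih => exact fun n hn => by rw [horner_succ v hf, h, ih (n + 1) (by omega)]
  exact key (N + 1) n (by omega)

theorem horner_add (v : M →ₗ[R] M) {f g : ℕ → M} (hf : f ∈ NatBdd R M) (hg : g ∈ NatBdd R M)
    (n : ℕ) : horner v (fun m => f m + g m) n = horner v f n + horner v g n :=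
  eq_horner v (Submodule.add_mem _ hf hg)
    (Submodule.add_mem _ (horner_mem v hf) (horner_mem v hg))
    (fun m => by
      simp only [Pi.add_apply, map_add]
      rw [horner_succ v hf m, horner_succ v hg m]; abel) n

theorem horner_smul (v : M →ₗ[R] M) (c : R) {f : ℕ → M} (hf : f ∈ NatBdd R M)
    (n : ℕ) : horner v (fun m => c • f m) n = c • horner v f n :=
  eq_horner v (Submodule.smul_mem _ c hf) (Submodule.smul_mem _ c (horner_mem v hf))
    (fun m => by
      simp only [Pi.smul_apply, map_smul]
      rw [horner_succ v hf m, smul_add]) n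

theorem horner_zero (v : M →ₗ[R] M) (n : ℕ) : horner v (fun _ => 0) n = 0 := by
  simp [horner]

theorem horner_shift_succ (v : M →ₗ[R] M) (f : ℕ → M) (a : M) (n : ℕ) :
    horner v (fun m => if m = 0 then a else f (m - 1)) (n + 1) = horner v f n := by
  refine finsum_congr fun j => ?_
  beta_reduce
  rw [if_neg (by omega), show n + 1 + j - 1 = n + j by omega]

theorem horner_single_succ (v : M →ₗ[R] M) (a : M) (n : ℕ) :
    horner v (fun m => if m = 0 then a else 0) (n + 1) = 0 :=
  (horner_shift_succ v (fun _ => 0) a n).trans (horner_zero v n)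

theorem horner_shift_zero (v : M →ₗ[R] M) {f : ℕ → M} (hf : f ∈ NatBdd R M) (a : M) :
    horner v (fun m => if m = 0 then a else f (m - 1)) 0 = a + v (horner v f 0) := by
  rw [horner_succ v (NatBdd.shift_mem hf a), horner_shift_succ, if_pos rfl]

theorem horner_single_zero (v : M →ₗ[R] M) (a : M) :
    horner v (fun m => if m = 0 then a else 0) 0 = a := by
  simpa [horner_zero] using horner_shift_zero v (f := fun _ => 0) (Submodule.zero_mem _) a

end Horner

namespace SComplexData

variable {R : Type u} [CommRing R] (X : SComplexData R)

theorem finsum_pow_v_zero (f : ℕ → X.Tot) :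
    ∑ᶠ i : ℕ, (X.v ^ i) (f i) = horner X.v f 0 := by
  simp [horner]

theorem finsum_pow_v_succ (f : ℕ → X.Tot) (n : ℕ) :
    ∑ᶠ j : ℕ, (X.v ^ j) (f (n + j + 1)) = horner X.v f (n + 1) := by
  simp only [horner, add_right_comm n 1]

theorem finsum_δ₁_pow_v_succ {f : ℕ → X.Tot} (hf : f ∈ NatBdd R X.Tot) (n : ℕ) :
    ∑ᶠ j : ℕ, X.δ₁ ((X.v ^ j) (f (n + j + 1))) = X.δ₁ (horner X.v f (n + 1)) := by
  simp only [map_horner X.v hf, add_right_comm n 1]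

variable {X}

theorem Hat.fst_mem (F : X.Hat) : (fun n => (F.1 n).1) ∈ NatBdd R X.Tot :=
  NatBdd.map_mem F.2 (LinearMap.fst R X.Tot (X.Tot × R))

theorem Hat.snd_mem (F : X.Hat) : (fun n => (F.1 n).2.1) ∈ NatBdd R X.Tot :=
  NatBdd.map_mem F.2 (LinearMap.fst R X.Tot R ∘ₗ LinearMap.snd R X.Tot (X.Tot × R))

theorem Hat.trd_mem (F : X.Hat) : (fun n => (F.1 n).2.2) ∈ NatBdd R R :=
  NatBdd.map_mem F.2 (LinearMap.snd R X.Tot R ∘ₗ LinearMap.snd R X.Tot (X.Tot × R))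

theorem Hat.ext {F G : X.Hat} (h₁ : ∀ n, (F.1 n).1 = (G.1 n).1)
    (h₂ : ∀ n, (F.1 n).2.1 = (G.1 n).2.1) (h₃ : ∀ n, (F.1 n).2.2 = (G.1 n).2.2) : F = G :=
  Subtype.ext <| funext fun n => Prod.ext (h₁ n) (Prod.ext (h₂ n) (h₃ n))

theorem Small.ext {z w : X.Small} (h₁ : z.1 = w.1) (h₂ : ∀ n, z.2.1 n = w.2.1 n) : z = w :=
  Prod.ext h₁ (Subtype.ext <| funext h₂)

theorem sumV_eq (f : ↥(NatBdd R R)) : X.sumV f = horner X.v (fun i => X.δ₂ (f.1 i)) 0 :=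
  X.finsum_pow_v_zero _

theorem phiHat_fst (F : X.Hat) : (X.phiHat F).1 = horner X.v (fun i => (F.1 i).2.1) 0 :=
  X.finsum_pow_v_zero _

theorem phiHat_snd (F : X.Hat) (n : ℕ) : (X.phiHat F).2.1 n =
    (F.1 n).2.2 + X.δ₁ (horner X.v (fun i => (F.1 i).2.1) (n + 1)) :=
  congrArg _ (X.finsum_δ₁_pow_v_succ F.snd_mem n)

theorem psiHat_apply (z : X.Small) (n : ℕ) : (X.psiHat z).1 n =
    (horner X.v (fun i => X.δ₂ (z.2.1 i)) (n + 1), if n = 0 then z.1 else 0, z.2.1 n) :=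
  congrArg (·, _) (X.finsum_pow_v_succ (fun i => X.δ₂ (z.2.1 i)) n)

theorem kHat_apply (F : X.Hat) (n : ℕ) : (X.kHat F).1 n =
    (-horner X.v (fun i => (F.1 i).2.1) (n + 1), 0, 0) :=
  congrArg (fun y => (-y, (0 : X.Tot), (0 : R)))
    (X.finsum_pow_v_succ (fun i => (F.1 i).2.1) n)

theorem hatD_fst (F : X.Hat) (n : ℕ) : ((X.hatD F).1 n).1 = -X.d (F.1 n).1 := by
  cases n <;> simp [hatD, dTilde, chiT]

theorem hatD_snd (F : X.Hat) (n : ℕ) : ((X.hatD F).1 n).2.1 =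
    -(X.v (F.1 n).1 - X.d (F.1 n).2.1 + X.δ₂ (F.1 n).2.2) +
      if n = 0 then 0 else (F.1 (n - 1)).1 := by
  cases n <;> simp [hatD, dTilde, chiT]

theorem hatD_trd (F : X.Hat) (n : ℕ) : ((X.hatD F).1 n).2.2 = -X.δ₁ (F.1 n).1 := by
  cases n <;> simp [hatD, dTilde, chiT]

namespace IsSComplex

theorem d_v_apply (hX : X.IsSComplex) (x : X.Tot) :
    X.d (X.v x) = X.v (X.d x) + X.δ₂ (X.δ₁ x) := by
  have h := LinearMap.congr_fun hX.d_v x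
  simp only [LinearMap.sub_apply, LinearMap.comp_apply, LinearMap.zero_apply] at h
  rw [← sub_eq_zero, ← sub_sub]
  exact h

theorem pow_v_δ₂_mem (hX : X.IsSComplex) (j : ℕ) (r : R) :
    (X.v ^ j) (X.δ₂ r) ∈ X.grading (-2 - 2 * j) := by
  induction j with
  | zero => simpa using hX.δ₂_deg (LinearMap.mem_range_self _ r)
  | succ j ih =>
    rw [pow_succ', Module.End.mul_apply]
    convert hX.v_deg _ (Submodule.mem_map_of_mem ih) using 2
    push_cast
    ring

theorem δ₁_pow_v_δ₂ (hX : X.IsSComplex) (j : ℕ) (r : R) : X.δ₁ ((X.v ^ j) (X.δ₂ r)) = 0 :=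
  hX.δ₁_deg _ (by omega) _ (hX.pow_v_δ₂_mem j r)

theorem δ₁_pow_v_d (hX : X.IsSComplex) (j : ℕ) (x : X.Tot) : X.δ₁ ((X.v ^ j) (X.d x)) = 0 := by
  induction j generalizing x with
  | zero => exact LinearMap.congr_fun hX.δ₁_d x
  | succ j ih =>
    rw [pow_succ, Module.End.mul_apply, eq_sub_of_add_eq (hX.d_v_apply x).symm, map_sub, map_sub,
      ih, hX.δ₁_pow_v_δ₂, sub_zero]

theorem d_pow_v_δ₂ (hX : X.IsSComplex) (j : ℕ) (r : R) : X.d ((X.v ^ j) (X.δ₂ r)) = 0 := by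
  induction j with
  | zero => exact LinearMap.congr_fun hX.d_δ₂ r
  | succ j ih =>
    rw [pow_succ', Module.End.mul_apply, hX.d_v_apply, ih, hX.δ₁_pow_v_δ₂, map_zero, map_zero,
      add_zero]

theorem d_horner (hX : X.IsSComplex) {f : ℕ → X.Tot} (hf : f ∈ NatBdd R X.Tot) (n : ℕ) :
    X.d (horner X.v f n) = horner X.v (fun m => X.d (f m)) n +
      horner X.v (fun m => X.δ₂ (X.δ₁ (horner X.v f (m + 1)))) n := by
  have hd := NatBdd.map_mem hf X.d
  have hδ := NatBdd.map_mem (NatBdd.tail_mem (horner_mem X.v hf) 1) (X.δ₂ ∘ₗ X.δ₁)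
  refine .trans ?_ (horner_add X.v hd hδ n)
  refine (eq_horner X.v (Submodule.add_mem _ hd hδ) (NatBdd.map_mem (horner_mem X.v hf) X.d)
    (fun m => ?_) n).symm
  rw [horner_succ X.v hf m, map_add, hX.d_v_apply]
  simp only [Pi.add_apply, LinearMap.comp_apply]
  abel

theorem horner_hatD (F : X.Hat) (n : ℕ) :
    horner X.v (fun i => ((X.hatD F).1 i).2.1) n =
      horner X.v (fun i => X.d (F.1 i).2.1) n - horner X.v (fun i => X.δ₂ (F.1 i).2.2) n +
        if n = 0 then 0 else (F.1 (n - 1)).1 := by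
  have hβ := NatBdd.map_mem F.snd_mem X.d
  have ha := NatBdd.map_mem F.trd_mem X.δ₂
  refine eq_horner X.v (X.hatD F).snd_mem
    (Submodule.add_mem _ (Submodule.sub_mem _ (horner_mem X.v hβ) (horner_mem X.v ha))
      (NatBdd.shift_mem F.fst_mem 0)) (fun m => ?_) n
  simp only [Pi.add_apply, Pi.sub_apply, hatD_snd, map_add, map_sub]
  rw [horner_succ X.v hβ m, horner_succ X.v ha m, if_neg m.succ_ne_zero, Nat.add_sub_cancel]
  abel

end IsSComplex

theorem isLinearMap_phiHat (X : SComplexData R) : IsLinearMap R X.phiHat where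
  map_add F G := by
    refine Small.ext ?_ fun n => ?_
    · change _ = (X.phiHat F).1 + (X.phiHat G).1
      simp only [phiHat_fst]
      exact horner_add X.v F.snd_mem G.snd_mem 0
    · change _ = (X.phiHat F).2.1 n + (X.phiHat G).2.1 n
      simp only [phiHat_snd]
      have h := horner_add X.v F.snd_mem G.snd_mem (n + 1)
      change (F.1 n).2.2 + (G.1 n).2.2 + X.δ₁ (horner X.v
        (fun i => (F.1 i).2.1 + (G.1 i).2.1) (n + 1)) = _
      rw [h, map_add]
      abel
  map_smul c F := by
    refine Small.ext ?_ fun n => ?_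
    · change _ = c • (X.phiHat F).1
      simp only [phiHat_fst]
      exact horner_smul X.v c F.snd_mem 0
    · change _ = c • (X.phiHat F).2.1 n
      simp only [phiHat_snd]
      change c • (F.1 n).2.2 + X.δ₁ (horner X.v (fun i => c • (F.1 i).2.1) (n + 1)) = _
      rw [horner_smul X.v c F.snd_mem, map_smul, smul_add]

theorem isLinearMap_psiHat (X : SComplexData R) : IsLinearMap R X.psiHat where
  map_add z w := by
    refine Subtype.ext (funext fun n => ?_)
    change _ = (X.psiHat z).1 n + (X.psiHat w).1 n
    simp only [psiHat_apply]
    have h := horner_add X.v (NatBdd.map_mem z.2.2 X.δ₂) (NatBdd.map_mem w.2.2 X.δ₂) (n + 1)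
    simp only [← map_add] at h
    refine Prod.ext h (Prod.ext ?_ rfl)
    cases n <;> simp
  map_smul c z := by
    refine Subtype.ext (funext fun n => ?_)
    change _ = c • (X.psiHat z).1 n
    simp only [psiHat_apply]
    have h := horner_smul X.v c (NatBdd.map_mem z.2.2 X.δ₂) (n + 1)
    simp only [← map_smul] at h
    refine Prod.ext h (Prod.ext ?_ rfl)
    cases n <;> simp

theorem horner_δ₂_phiHat_snd (F : X.Hat) (n : ℕ) :
    horner X.v (fun i => X.δ₂ ((X.phiHat F).2.1 i)) n =
      horner X.v (fun i => X.δ₂ (F.1 i).2.2) n +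
      horner X.v (fun i => X.δ₂ (X.δ₁ (horner X.v (fun i => (F.1 i).2.1) (i + 1)))) n := by
  simp only [phiHat_snd, map_add]
  exact horner_add X.v (NatBdd.map_mem F.trd_mem X.δ₂)
    (NatBdd.map_mem (NatBdd.tail_mem (horner_mem X.v F.snd_mem) 1) (X.δ₂ ∘ₗ X.δ₁)) n

theorem IsSComplex.smallD_phiHat (hX : X.IsSComplex) (F : X.Hat) :
    X.smallD (X.phiHat F) = X.phiHat (X.hatD F) := by
  refine Small.ext ?_ fun n => ?_
  · simp only [smallD, sumV_eq, phiHat_fst, horner_hatD, hX.d_horner F.snd_mem,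
      horner_δ₂_phiHat_snd, if_true]
    abel
  · simp only [phiHat_snd, hatD_trd, horner_hatD, map_add, map_sub]
    rw [map_horner_eq_zero X.v (NatBdd.map_mem F.snd_mem X.d) X.δ₁ fun j m => hX.δ₁_pow_v_d j _,
      map_horner_eq_zero X.v (NatBdd.map_mem F.trd_mem X.δ₂) X.δ₁ fun j m => hX.δ₁_pow_v_δ₂ j _]
    simp [smallD]

theorem IsSComplex.hatD_psiHat (hX : X.IsSComplex) (z : X.Small) :
    X.hatD (X.psiHat z) = X.psiHat (X.smallD z) := by
  have ha := NatBdd.map_mem z.2.2 X.δ₂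
  refine Hat.ext (fun n => ?_) (fun n => ?_) fun n => ?_
  · rw [hatD_fst, psiHat_apply, psiHat_apply,
      map_horner_eq_zero X.v ha X.d fun j m => hX.d_pow_v_δ₂ j _]
    simp [smallD, horner_zero]
  · simp only [hatD_snd, psiHat_apply, smallD, sumV_eq]
    cases n with
    | zero =>
      rw [horner_succ X.v ha 0]
      simp
      abel
    | succ n =>
      simp only [Nat.add_sub_cancel, if_neg n.succ_ne_zero, map_zero]
      rw [horner_succ X.v ha (n + 1)]
      abel
  · rw [hatD_trd, psiHat_apply, psiHat_apply,
      map_horner_eq_zero X.v ha X.δ₁ fun j m => hX.δ₁_pow_v_δ₂ j _]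
    simp [smallD]

theorem phiHat_xHat (F : X.Hat) : X.phiHat (X.xHat F) = X.xSmall (X.phiHat F) := by
  have hx : (fun i => ((X.xHat F).1 i).2.1) = fun i => if i = 0 then 0 else (F.1 (i - 1)).2.1 := by
    funext i
    cases i <;> simp [xHat]
  refine Small.ext ?_ fun n => ?_
  · simp only [phiHat_fst, hx, xSmall]
    rw [horner_shift_zero X.v F.snd_mem, zero_add]
  · rw [phiHat_snd, hx, horner_shift_succ X.v (fun i => (F.1 i).2.1)]
    cases n with
    | zero => simp [xHat, xSmall, phiHat_fst]
    | succ n => simp [xHat, xSmall, phiHat_snd]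

/-- The inclusion `(α, p(x)) ↦ (α, 0, 0)` in degree `0` in `x`: a chain homotopy between
`x ∘ Ψ̂` and `Ψ̂ ∘ x`. -/
noncomputable def xPsiHomotopy (X : SComplexData R) : X.Small → X.Hat := fun z =>
  ⟨fun n => (if n = 0 then z.1 else 0, 0, 0), 0, fun n hn => by simp [hn.ne']⟩

theorem isLinearMap_xPsiHomotopy (X : SComplexData R) : IsLinearMap R X.xPsiHomotopy where
  map_add z w := by
    refine Subtype.ext (funext fun n => ?_)
    cases n <;> simp [xPsiHomotopy]
  map_smul c z := by
    refine Subtype.ext (funext fun n => ?_)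
    cases n <;> simp [xPsiHomotopy]

theorem xHat_psiHat_sub (z : X.Small) : X.xHat (X.psiHat z) - X.psiHat (X.xSmall z) =
    X.hatD (X.xPsiHomotopy z) + X.xPsiHomotopy (X.smallD z) := by
  have hx : (fun i => X.δ₂ ((X.xSmall z).2.1 i)) =
      fun i => if i = 0 then X.δ₂ (X.δ₁ z.1) else X.δ₂ (z.2.1 (i - 1)) := by
    funext i
    cases i <;> simp [xSmall]
  have hs := horner_shift_succ X.v (fun i => X.δ₂ (z.2.1 i)) (X.δ₂ (X.δ₁ z.1))
  refine Hat.ext (fun n => ?_) (fun n => ?_) fun n => ?_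
  · change ((X.xHat (X.psiHat z)).1 n).1 - ((X.psiHat (X.xSmall z)).1 n).1 =
      ((X.hatD (X.xPsiHomotopy z)).1 n).1 + ((X.xPsiHomotopy (X.smallD z)).1 n).1
    rw [hatD_fst, psiHat_apply, hx, hs]
    cases n with
    | zero =>
      simp [xHat, xPsiHomotopy, smallD, sumV_eq]
      abel
    | succ n => simp [xHat, psiHat_apply, xPsiHomotopy]
  · change ((X.xHat (X.psiHat z)).1 n).2.1 - ((X.psiHat (X.xSmall z)).1 n).2.1 =
      ((X.hatD (X.xPsiHomotopy z)).1 n).2.1 + ((X.xPsiHomotopy (X.smallD z)).1 n).2.1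
    rw [hatD_snd, psiHat_apply]
    cases n <;> simp [xHat, psiHat_apply, xPsiHomotopy, xSmall]
  · change ((X.xHat (X.psiHat z)).1 n).2.2 - ((X.psiHat (X.xSmall z)).1 n).2.2 =
      ((X.hatD (X.xPsiHomotopy z)).1 n).2.2 + ((X.xPsiHomotopy (X.smallD z)).1 n).2.2
    rw [hatD_trd, psiHat_apply]
    cases n <;> simp [xHat, psiHat_apply, xPsiHomotopy, xSmall]

theorem phiHat_psiHat (z : X.Small) : X.phiHat (X.psiHat z) = z := by
  refine Small.ext ?_ fun n => ?_
  · simp only [phiHat_fst, psiHat_apply, horner_single_zero]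
  · simp only [phiHat_snd, psiHat_apply, horner_single_succ, map_zero, add_zero]

theorem IsSComplex.psiHat_phiHat_sub (hX : X.IsSComplex) (F : X.Hat) :
    X.psiHat (X.phiHat F) - F = X.hatD (X.kHat F) + X.kHat (X.hatD F) := by
  refine Hat.ext (fun n => ?_) (fun n => ?_) fun n => ?_
  · change ((X.psiHat (X.phiHat F)).1 n).1 - (F.1 n).1 =
      ((X.hatD (X.kHat F)).1 n).1 + ((X.kHat (X.hatD F)).1 n).1
    simp only [hatD_fst, psiHat_apply, kHat_apply, horner_hatD, horner_δ₂_phiHat_snd, map_neg,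
      hX.d_horner F.snd_mem, if_neg n.succ_ne_zero, Nat.add_sub_cancel]
    abel
  · change ((X.psiHat (X.phiHat F)).1 n).2.1 - (F.1 n).2.1 =
      ((X.hatD (X.kHat F)).1 n).2.1 + ((X.kHat (X.hatD F)).1 n).2.1
    simp only [hatD_snd, psiHat_apply, kHat_apply, phiHat_fst]
    rw [map_neg, eq_sub_of_add_eq' (horner_succ X.v F.snd_mem n).symm]
    cases n with
    | zero => simp
    | succ n =>
      simp
      abel
  · change ((X.psiHat (X.phiHat F)).1 n).2.2 - (F.1 n).2.2 =
      ((X.hatD (X.kHat F)).1 n).2.2 + ((X.kHat (X.hatD F)).1 n).2.2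
    simp [hatD_trd, psiHat_apply, kHat_apply, phiHat_snd]

end SComplexData

open SComplexData in
/-- For an S-complex `C̃` over a commutative ring `R`, the maps
`Φ̂ : Ĉ → 𝔣Ĉ` and `Ψ̂ : 𝔣Ĉ → Ĉ` between the large and small equivariant
complexes are chain maps; `Φ̂` commutes with the action of `x`; `Ψ̂` commutes
with the action of `x` up to chain homotopy; `Φ̂ ∘ Ψ̂ = id`; and `Ψ̂ ∘ Φ̂` is
chain homotopic to the identity via the explicit homotopy `K̂`. -/
theorem statement0 {R : Type u} [CommRing R] (A : SComplexData R) (hA : A.IsSComplex) :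
    IsLinearMap R A.phiHat ∧ IsLinearMap R A.psiHat ∧
    (∀ z : A.Hat, A.smallD (A.phiHat z) = A.phiHat (A.hatD z)) ∧
    (∀ z : A.Small, A.hatD (A.psiHat z) = A.psiHat (A.smallD z)) ∧
    (∀ z : A.Hat, A.phiHat (A.xHat z) = A.xSmall (A.phiHat z)) ∧
    (∃ K : A.Small → A.Hat, IsLinearMap R K ∧ ∀ z : A.Small,
        A.xHat (A.psiHat z) - A.psiHat (A.xSmall z) = A.hatD (K z) + K (A.smallD z)) ∧
    (∀ z : A.Small, A.phiHat (A.psiHat z) = z) ∧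
    (∀ z : A.Hat, A.psiHat (A.phiHat z) - z = A.hatD (A.kHat z) + A.kHat (A.hatD z)) :=
  ⟨isLinearMap_phiHat A, isLinearMap_psiHat A, hA.smallD_phiHat, hA.hatD_psiHat, phiHat_xHat,
    ⟨A.xPsiHomotopy, isLinearMap_xPsiHomotopy A, xHat_psiHat_sub⟩, phiHat_psiHat,
    hA.psiHat_phiHat_sub⟩
end

section
/- Let R be an integral domain and let C̃ and C̃' be S-complexes over R. Then the Frøyshov invariant is additive under tensor product: h(C̃ ⊗ C̃') = h(C̃) + h(C̃'). -/
/-!  S-complexes over a commutative ring `R` (following Daemi–Scaduto).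

An S-complex is a ℤ-graded finitely generated free chain complex
`C̃ = C ⊕ C[1] ⊕ R` determined by the data of `C` together with maps
`d, v, δ₁, δ₂`.  We encode the graded module `C` by a single module `Tot`
together with an internal ℤ-grading by submodules, and we carry the sign
map `ε` (multiplication by `(-1)^i` on the degree `i` part) as data. -/

universe u

namespace SComplexData

open TensorProduct

variable {R : Type u} [CommRing R]

/-- The carrier of the tensor product S-complex:
`C^⊗ = (C ⊗ C') ⊕ (C ⊗ C')[1] ⊕ C ⊕ C'`. -/
abbrev TTen (A B : SComplexData R) : Type u :=
  (A.Tot ⊗[R] B.Tot) × (A.Tot ⊗[R] B.Tot) × A.Tot × B.Tot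

/-- Projection onto the first summand `(C ⊗ C')` of `C^⊗`. -/
noncomputable def tp1 (A B : SComplexData R) : TTen A B →ₗ[R] A.Tot ⊗[R] B.Tot :=
  LinearMap.fst R _ _

/-- Projection onto the second summand `(C ⊗ C')[1]` of `C^⊗`. -/
noncomputable def tp2 (A B : SComplexData R) : TTen A B →ₗ[R] A.Tot ⊗[R] B.Tot :=
  (LinearMap.fst R _ _) ∘ₗ (LinearMap.snd R _ _)

/-- Projection onto the third summand `C` of `C^⊗`. -/
noncomputable def tp3 (A B : SComplexData R) : TTen A B →ₗ[R] A.Tot :=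
  (LinearMap.fst R _ _) ∘ₗ (LinearMap.snd R _ _) ∘ₗ (LinearMap.snd R _ _)

/-- Projection onto the fourth summand `C'` of `C^⊗`. -/
noncomputable def tp4 (A B : SComplexData R) : TTen A B →ₗ[R] B.Tot :=
  (LinearMap.snd R _ _) ∘ₗ (LinearMap.snd R _ _) ∘ₗ (LinearMap.snd R _ _)

/-- The degree `k` piece of the grading of `C ⊗ C'`:
the span of the images of `C_i ⊗ C'_{k-i}`. -/
noncomputable def gradedPiece (A B : SComplexData R) (k : ℤ) :
    Submodule R (A.Tot ⊗[R] B.Tot) :=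
  ⨆ i : ℤ, LinearMap.range
    (TensorProduct.map (A.grading i).subtype (B.grading (k - i)).subtype)

/-- The tensor product S-complex `C̃ ⊗ C̃'` of two S-complexes, with chain module
`C^⊗ = (C ⊗ C') ⊕ (C ⊗ C')[1] ⊕ C ⊕ C'` and the block-matrix structure maps of
Daemi–Scaduto (Section 4.5); `ε` denotes the sign map. -/
noncomputable def tensorS (A B : SComplexData R) : SComplexData R where
  Tot := TTen A B
  grading := fun k =>
    (gradedPiece A B k).prod ((gradedPiece A B (k - 1)).prod
      ((A.grading k).prod (B.grading k)))
  sign := LinearMap.prod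
      ((TensorProduct.map A.sign B.sign) ∘ₗ tp1 A B)
      (LinearMap.prod (-((TensorProduct.map A.sign B.sign) ∘ₗ tp2 A B))
        (LinearMap.prod (A.sign ∘ₗ tp3 A B) (B.sign ∘ₗ tp4 A B)))
  d := LinearMap.prod
      -- row 1 :  (d⊗1 + ε⊗d') x₁
      ((TensorProduct.map A.d LinearMap.id + TensorProduct.map A.sign B.d) ∘ₗ tp1 A B)
      (LinearMap.prod
        -- row 2 : (−εv⊗1 + ε⊗v') x₁ + (d⊗1 − ε⊗d') x₂ + (ε⊗δ₂') x₃ − (δ₂⊗1) x₄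
        ((TensorProduct.map A.sign B.v - TensorProduct.map (A.sign ∘ₗ A.v) LinearMap.id) ∘ₗ tp1 A B
          + (TensorProduct.map A.d LinearMap.id - TensorProduct.map A.sign B.d) ∘ₗ tp2 A B
          + ((TensorProduct.map A.sign B.δ₂) ∘ₗ (TensorProduct.rid R A.Tot).symm.toLinearMap) ∘ₗ tp3 A B
          - ((TensorProduct.map A.δ₂ LinearMap.id) ∘ₗ (TensorProduct.lid R B.Tot).symm.toLinearMap) ∘ₗ tp4 A B)
        (LinearMap.prod
          -- row 3 : (ε⊗δ₁') x₁ + d x₃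
          (((TensorProduct.rid R A.Tot).toLinearMap ∘ₗ TensorProduct.map A.sign B.δ₁) ∘ₗ tp1 A B
            + A.d ∘ₗ tp3 A B)
          -- row 4 : (δ₁⊗1) x₁ + d' x₄
          (((TensorProduct.lid R B.Tot).toLinearMap ∘ₗ TensorProduct.map A.δ₁ LinearMap.id) ∘ₗ tp1 A B
            + B.d ∘ₗ tp4 A B)))
  v := LinearMap.prod
      -- row 1 : (v⊗1) x₁ + (δ₂⊗1) x₄
      ((TensorProduct.map A.v LinearMap.id) ∘ₗ tp1 A B
        + ((TensorProduct.map A.δ₂ LinearMap.id) ∘ₗ (TensorProduct.lid R B.Tot).symm.toLinearMap) ∘ₗ tp4 A B)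
      (LinearMap.prod
        -- row 2 : (v⊗1) x₂
        ((TensorProduct.map A.v LinearMap.id) ∘ₗ tp2 A B)
        (LinearMap.prod
          -- row 3 : v x₃
          (A.v ∘ₗ tp3 A B)
          -- row 4 : (δ₁⊗1) x₂ + v' x₄
          (((TensorProduct.lid R B.Tot).toLinearMap ∘ₗ TensorProduct.map A.δ₁ LinearMap.id) ∘ₗ tp2 A B
            + B.v ∘ₗ tp4 A B)))
  δ₁ := A.δ₁ ∘ₗ tp3 A B + B.δ₁ ∘ₗ tp4 A B
  δ₂ := LinearMap.prod 0 (LinearMap.prod 0 (LinearMap.prod A.δ₂ B.δ₂))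

end SComplexData

namespace Froyshov

open Polynomial TensorProduct LaurentSeries

section Series

variable {R M : Type*} [CommRing R] [AddCommGroup M] [Module R M]

/-- The variable `x` of `R[[x⁻¹, x]]`, realized as Laurent series in `x⁻¹`. -/
noncomputable def xvar (R : Type*) [CommRing R] : R⸨X⸩ := HahnSeries.single (-1) 1

/-- The inclusion of `R[x]` into `R[[x⁻¹, x]]`. -/
noncomputable def polyIncl (R : Type*) [CommRing R] : R[X] →+* R⸨X⸩ :=
  eval₂RingHom HahnSeries.C (xvar R)

/-- The series `∑ₖ φ(vᵏ m) x^{-k-1}`. -/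
noncomputable def tail (φ : M →ₗ[R] R) (v : Module.End R M) : M →+ R⸨X⸩ where
  toFun m := HahnSeries.single 1 1 *
    HahnSeries.ofPowerSeries ℤ R (PowerSeries.mk fun k => φ ((v ^ k) m))
  map_zero' := by
    rw [show (PowerSeries.mk fun k => φ ((v ^ k) 0)) = 0 by ext; simp, map_zero, mul_zero]
  map_add' a b := by
    rw [← mul_add, ← map_add]
    congr 2
    ext k
    simp

theorem tail_apply (φ : M →ₗ[R] R) (v : Module.End R M) (m : M) :
    tail φ v m = HahnSeries.single 1 1 *
      HahnSeries.ofPowerSeries ℤ R (PowerSeries.mk fun k => φ ((v ^ k) m)) := rfl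

theorem coeff_tail (φ : M →ₗ[R] R) (v : Module.End R M) (m : M) (n : ℤ) :
    (tail φ v m).coeff n = if 0 < n then φ ((v ^ (n - 1).toNat) m) else 0 := by
  rw [tail_apply, HahnSeries.coeff_single_mul, one_mul, PowerSeries.coeff_coe]
  by_cases h : 0 < n
  · rw [if_neg (by omega), if_pos h, PowerSeries.coeff_mk]
    congr 3
    omega
  · rw [if_pos (by omega), if_neg h]

theorem tail_congr {N : Type*} [AddCommGroup N] [Module R N] {φ : M →ₗ[R] R}
    {v : Module.End R M} {m : M} {ψ : N →ₗ[R] R} {w : Module.End R N} {n : N}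
    (h : ∀ k, φ ((v ^ k) m) = ψ ((w ^ k) n)) : tail φ v m = tail ψ w n := by
  simp only [tail_apply, h]

theorem tail_smul (φ : M →ₗ[R] R) (v : Module.End R M) (r : R) (m : M) :
    tail φ v (r • m) = HahnSeries.C r * tail φ v m := by
  ext n
  rw [HahnSeries.C_mul_eq_smul, HahnSeries.coeff_smul, coeff_tail, coeff_tail]
  simp

theorem xvar_mul_tail (φ : M →ₗ[R] R) (v : Module.End R M) (m : M) :
    xvar R * tail φ v m = HahnSeries.C (φ m) + tail φ v (v m) := by
  ext n
  rw [xvar, HahnSeries.coeff_single_mul, one_mul, HahnSeries.coeff_add, coeff_tail, coeff_tail,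
    HahnSeries.C_apply]
  rcases lt_trichotomy n 0 with h | rfl | h
  · rw [if_neg (by omega), if_neg (by omega), HahnSeries.coeff_single_of_ne h.ne, add_zero]
  · simp
  · rw [if_pos (by omega), if_pos h, HahnSeries.coeff_single_of_ne h.ne', zero_add,
      ← Module.End.mul_apply, ← pow_succ]
    congr 3
    omega

@[simp]
theorem polyIncl_X : polyIncl R X = xvar R := by simp [polyIncl]

@[simp]
theorem polyIncl_C (a : R) : polyIncl R (C a) = HahnSeries.C a := by simp [polyIncl]

theorem coeff_polyIncl (p : R[X]) (n : ℤ) :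
    (polyIncl R p).coeff n = if n ≤ 0 then p.coeff n.natAbs else 0 := by
  induction p using Polynomial.induction_on' with
  | add p q hp hq => rw [map_add, HahnSeries.coeff_add, hp, hq]; split_ifs <;> simp
  | monomial k a =>
    have h : xvar R ^ k = HahnSeries.single (-(k : ℤ)) 1 := by
      rw [xvar, HahnSeries.single_pow]; simp
    rw [← C_mul_X_pow_eq_monomial, map_mul, map_pow, polyIncl_X, polyIncl_C, h,
      HahnSeries.C_mul_eq_smul, HahnSeries.coeff_smul, HahnSeries.coeff_single, coeff_C_mul_X_pow]
    split_ifs <;> first | omega | simp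

theorem polyIncl_mul_tail (φ : M →ₗ[R] R) (v : Module.End R M) (p : R[X]) (m : M) :
    ∃ q : R[X], polyIncl R p * tail φ v m = polyIncl R q + tail φ v (aeval v p m) := by
  induction p using Polynomial.induction_on generalizing m with
  | C a => exact ⟨0, by simp [tail_smul]⟩
  | add p₁ p₂ h₁ h₂ =>
    obtain ⟨q₁, h₁⟩ := h₁ m
    obtain ⟨q₂, h₂⟩ := h₂ m
    refine ⟨q₁ + q₂, ?_⟩
    rw [map_add, add_mul, h₁, h₂, map_add, map_add, LinearMap.add_apply, map_add]
    ring
  | monomial k a h =>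
    obtain ⟨q, h⟩ := h (v m)
    refine ⟨C a * X ^ k * C (φ m) + q, ?_⟩
    rw [pow_succ, ← mul_assoc, map_mul _ _ X, mul_assoc, polyIncl_X, xvar_mul_tail, mul_add, h,
      map_add, map_mul _ _ (C (φ m)), polyIncl_C, map_mul (aeval v) _ X, aeval_X,
      Module.End.mul_apply, add_assoc]

end Series

section Degree

variable {R M : Type*} [CommRing R] [AddCommGroup M] [Module R M]

/-- The differential of the small equivariant complex, with `e = δ₂(1)`. -/
noncomputable def bdry (d v : Module.End R M) (e : M) : M × R[X] →ₗ[R] M :=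
  d ∘ₗ LinearMap.fst R M R[X] -
    LinearMap.applyₗ e ∘ₗ (aeval v).toLinearMap ∘ₗ LinearMap.snd R M R[X]

@[simp]
theorem bdry_mk (d v : Module.End R M) (e m : M) (p : R[X]) :
    bdry d v e (m, p) = d m - aeval v p e := rfl

/-- The map `𝔦` from the small equivariant complex to `R[[x⁻¹, x]]`. -/
noncomputable def laurent (v : Module.End R M) (δ : M →ₗ[R] R) : M × R[X] →+ R⸨X⸩ :=
  (tail δ v).comp (AddMonoidHom.fst M R[X]) +
    (polyIncl R).toAddMonoidHom.comp (AddMonoidHom.snd M R[X])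

@[simp]
theorem laurent_mk (v : Module.End R M) (δ : M →ₗ[R] R) (m : M) (p : R[X]) :
    laurent v δ (m, p) = tail δ v m + polyIncl R p := rfl

/-- The integer `n` is the degree of the image under `𝔦` of a cycle. -/
def HasDeg (d v : Module.End R M) (δ : M →ₗ[R] R) (e : M) (n : ℤ) : Prop :=
  ∃ z, bdry d v e z = 0 ∧ laurent v δ z ≠ 0 ∧ (laurent v δ z).order = -n

theorem order_eq_iff (f : R⸨X⸩) (n : ℤ) :
    f ≠ 0 ∧ f.order = n ↔ f.coeff n ≠ 0 ∧ ∀ m < n, f.coeff m = 0 := by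
  constructor
  · rintro ⟨h, rfl⟩
    exact ⟨HahnSeries.coeff_order_eq_zero.not.2 h, fun m => HahnSeries.coeff_eq_zero_of_lt_order⟩
  · rintro ⟨h, h'⟩
    have hf : f ≠ 0 := by rintro rfl; simp at h
    refine ⟨hf, le_antisymm (HahnSeries.order_le_of_coeff_ne_zero h) (not_lt.1 fun hlt => ?_)⟩
    exact hf (HahnSeries.coeff_order_eq_zero.1 (h' _ hlt))

theorem coeff_laurent (v : Module.End R M) (δ : M →ₗ[R] R) (m : M) (p : R[X]) (n : ℤ) :
    (laurent v δ (m, p)).coeff n =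
      if 0 < n then δ ((v ^ (n - 1).toNat) m) else p.coeff n.natAbs := by
  rw [laurent_mk, HahnSeries.coeff_add, coeff_tail, coeff_polyIncl]
  split_ifs <;> first | omega | simp

/-- The relation `d v - v d = δ₂ δ₁` of an S-complex. -/
def CommRel (d v : Module.End R M) (δ : M →ₗ[R] R) (e : M) : Prop :=
  ∀ x, d (v x) = v (d x) + δ x • e

variable {d v : Module.End R M} {δ : M →ₗ[R] R} {e : M}

theorem exists_mul_X (h : CommRel d v δ e) (z : M × R[X]) :
    ∃ z', bdry d v e z' = v (bdry d v e z) ∧ laurent v δ z' = xvar R * laurent v δ z := by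
  obtain ⟨m, p⟩ := z
  refine ⟨(v m, C (δ m) + X * p), ?_, ?_⟩
  · simp only [bdry_mk, h m, map_add, map_mul, aeval_C, aeval_X, LinearMap.add_apply,
      Module.algebraMap_end_apply, Module.End.mul_apply, map_sub]
    abel
  · rw [laurent_mk, laurent_mk, mul_add, xvar_mul_tail, map_add, map_mul, polyIncl_X, polyIncl_C]
    ring

theorem exists_poly_mul (h : CommRel d v δ e) (p : R[X]) (z : M × R[X]) :
    ∃ z', bdry d v e z' = aeval v p (bdry d v e z) ∧
      laurent v δ z' = polyIncl R p * laurent v δ z := by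
  induction p using Polynomial.induction_on generalizing z with
  | C a =>
    obtain ⟨m, p⟩ := z
    refine ⟨(a • m, C a * p), by simp [smul_sub], ?_⟩
    rw [laurent_mk, laurent_mk, tail_smul, map_mul, polyIncl_C, mul_add]
  | add p₁ p₂ h₁ h₂ =>
    obtain ⟨z₁, h₁, h₁'⟩ := h₁ z
    obtain ⟨z₂, h₂, h₂'⟩ := h₂ z
    exact ⟨z₁ + z₂, by rw [map_add, h₁, h₂, map_add, LinearMap.add_apply],
      by rw [map_add, h₁', h₂', map_add, add_mul]⟩
  | monomial k a ih =>
    obtain ⟨z₁, h₁, h₁'⟩ := exists_mul_X h z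
    obtain ⟨z₂, h₂, h₂'⟩ := ih z₁
    refine ⟨z₂, ?_, ?_⟩
    · rw [h₂, h₁, pow_succ, ← mul_assoc, map_mul (aeval v) _ X, aeval_X, Module.End.mul_apply]
    · rw [h₂', h₁', pow_succ, ← mul_assoc (C a), map_mul (polyIncl R) _ X, polyIncl_X, mul_assoc]

theorem hasDeg_of_coeff {z : M × R[X]} {n : ℤ} (h₀ : bdry d v e z = 0)
    (h₁ : (laurent v δ z).coeff (-n) ≠ 0) (h₂ : ∀ m < -n, (laurent v δ z).coeff m = 0) :
    HasDeg d v δ e n :=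
  ⟨z, h₀, (order_eq_iff _ _).2 ⟨h₁, h₂⟩⟩

theorem exists_hasDeg_of_ne_zero {z : M × R[X]} (h₀ : bdry d v e z = 0)
    (h : laurent v δ z ≠ 0) : ∃ n, HasDeg d v δ e n :=
  ⟨-(laurent v δ z).order, z, h₀, h, by simp⟩

end Degree

section Duality

variable {R M N : Type*} [CommRing R] [AddCommGroup M] [Module R M] [AddCommGroup N] [Module R N]

theorem tail_mul_tail (φ : M →ₗ[R] R) (v : Module.End R M) (m : M)
    (ψ : N →ₗ[R] R) (w : Module.End R N) (n : N) (F : ℕ → R) (h₀ : F 0 = 0)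
    (h : ∀ k, F (k + 1) =
      ∑ ij ∈ Finset.HasAntidiagonal.antidiagonal k, φ ((v ^ ij.1) m) * ψ ((w ^ ij.2) n)) :
    tail φ v m * tail ψ w n =
      HahnSeries.single 1 1 * HahnSeries.ofPowerSeries ℤ R (PowerSeries.mk F) := by
  have hF : PowerSeries.mk F = PowerSeries.X * ((PowerSeries.mk fun k => φ ((v ^ k) m)) *
      PowerSeries.mk fun k => ψ ((w ^ k) n)) := by
    ext k
    cases k with
    | zero => simp [h₀]
    | succ k => rw [PowerSeries.coeff_succ_X_mul, PowerSeries.coeff_mul]; simp [h]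
  rw [hF, map_mul, map_mul, HahnSeries.ofPowerSeries_X, tail_apply, tail_apply]
  ring

variable {d v : Module.End R M} {δ : M →ₗ[R] R} {e : M}

theorem CommRel.pow_succ (h : CommRel d v δ e) (x : M) (k : ℕ) :
    d ((v ^ (k + 1)) x) = (v ^ (k + 1)) (d x) +
      ∑ ij ∈ Finset.HasAntidiagonal.antidiagonal k, δ ((v ^ ij.1) x) • (v ^ ij.2) e := by
  induction k with
  | zero => simp [h x]
  | succ k ih =>
    rw [pow_succ' v (k + 1), Module.End.mul_apply, h, ih, Finset.Nat.sum_antidiagonal_succ',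
      map_add, map_sum]
    simp only [map_smul, pow_zero, Module.End.one_apply, pow_succ' v, Module.End.mul_apply]
    abel

theorem tail_mul_tail_of_commRel (h : CommRel d v δ e) (f : M →ₗ[R] R) (b : M) :
    tail δ v b * tail f v e = tail (f ∘ₗ d) v b - tail f v (d b) := by
  rw [tail_mul_tail δ v b f v e (fun k => f (d ((v ^ k) b)) - f ((v ^ k) (d b))) (by simp),
    tail_apply, tail_apply, ← mul_sub, ← map_sub]
  · rfl
  · intro k
    simp [h.pow_succ b k]

theorem dualMap_pow_apply (v : Module.End R M) (k : ℕ) (f : Module.Dual R M) (x : M) :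
    ((v.dualMap : Module.End R (Module.Dual R M)) ^ k) f x = f ((v ^ k) x) := by
  induction k generalizing x with
  | zero => rfl
  | succ k ih => rw [pow_succ', Module.End.mul_apply, LinearMap.dualMap_apply, ih, pow_succ,
      Module.End.mul_apply]

theorem map_aeval_of_pow {v : Module.End R M} {w : Module.End R N} (f : M →ₗ[R] N) (m : M)
    (n : N) (h : ∀ k, f ((v ^ k) m) = (w ^ k) n) (p : R[X]) :
    f (aeval v p m) = aeval w p n := by
  simp only [aeval_eq_sum_range, LinearMap.sum_apply, LinearMap.smul_apply, map_sum, map_smul, h]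

theorem pow_apply_of_comm {v : Module.End R M} {w : Module.End R N} (f : M →ₗ[R] N)
    (h : ∀ x, f (v x) = w (f x)) (m : M) (k : ℕ) : f ((v ^ k) m) = (w ^ k) (f m) := by
  induction k generalizing m with
  | zero => rfl
  | succ k ih => rw [pow_succ, Module.End.mul_apply, ih, h, pow_succ, Module.End.mul_apply]

theorem map_aeval {v : Module.End R M} {w : Module.End R N} (f : M →ₗ[R] N)
    (h : ∀ x, f (v x) = w (f x)) (p : R[X]) (m : M) : f (aeval v p m) = aeval w p (f m) :=
  map_aeval_of_pow f m (f m) (pow_apply_of_comm f h m) p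

theorem aeval_dualMap_apply (v : Module.End R M) (p : R[X]) (f : Module.Dual R M) (x : M) :
    aeval (v.dualMap : Module.End R (Module.Dual R M)) p f x = f (aeval v p x) := by
  simp only [aeval_eq_sum_range, LinearMap.sum_apply, LinearMap.smul_apply, map_sum, map_smul,
    dualMap_pow_apply]

/-- `HasDeg` for the dual S-complex. -/
def HasDegDual (d v : Module.End R M) (δ : M →ₗ[R] R) (e : M) (n : ℤ) : Prop :=
  HasDeg (-d.dualMap) v.dualMap (Module.Dual.eval R M e) δ n

theorem HasDeg.map {d v : Module.End R M} {δ : M →ₗ[R] R} {e : M} {d' v' : Module.End R N}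
    {δ' : N →ₗ[R] R} {e' : N} {n : ℤ} (f : M →ₗ[R] N) (hd : ∀ x, f (d x) = d' (f x))
    (hv : ∀ x, f (v x) = v' (f x)) (hδ : ∀ x, δ' (f x) = δ x) (he : f e = e')
    (h : HasDeg d v δ e n) : HasDeg d' v' δ' e' n := by
  obtain ⟨⟨b, p⟩, h₁, h₂⟩ := h
  have hl : laurent v' δ' (f b, p) = laurent v δ (b, p) := by
    rw [laurent_mk, laurent_mk]
    congr 1
    exact tail_congr fun k => by rw [← pow_apply_of_comm f hv, hδ]
  refine ⟨(f b, p), ?_, by rwa [hl]⟩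
  rw [bdry_mk, ← hd, ← he, ← map_aeval f hv, ← map_sub, ← bdry_mk, h₁, map_zero]

theorem HasDeg.add_nonneg [IsDomain R] {n m : ℤ} (h : CommRel d v δ e) (hn : HasDeg d v δ e n)
    (hm : HasDegDual d v δ e m) : 0 ≤ n + m := by
  obtain ⟨⟨b, p⟩, hb, hb₀, hbn⟩ := hn
  obtain ⟨⟨f, q⟩, hf, hf₀, hfm⟩ := hm
  rw [bdry_mk, sub_eq_zero] at hb hf
  have key : ∃ r, laurent v δ (b, p) *
      laurent (v.dualMap : Module.End R (Module.Dual R M)) (Module.Dual.eval R M e) (f, q) =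
        polyIncl R r := by
    obtain ⟨r₁, h₁⟩ := polyIncl_mul_tail f v p e
    obtain ⟨r₂, h₂⟩ := polyIncl_mul_tail δ v q b
    have h₃ : tail (Module.Dual.eval R M e)
        (v.dualMap : Module.End R (Module.Dual R M)) f = tail f v e :=
      tail_congr fun k => by rw [Module.Dual.eval_apply, dualMap_pow_apply]
    have h₄ : tail δ v (aeval v q b) = - tail (f ∘ₗ d) v b := by
      rw [← map_neg]
      refine tail_congr fun k => ?_
      have hc : ∀ x, (v ^ k) (v x) = v ((v ^ k) x) := fun x => by
        rw [← Module.End.mul_apply, ← pow_succ, pow_succ', Module.End.mul_apply]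
      rw [map_aeval (v ^ k) hc, ← aeval_dualMap_apply, ← hf, map_neg, map_neg]
      rfl
    refine ⟨r₁ + r₂ + p * q, ?_⟩
    rw [laurent_mk, laurent_mk, h₃, add_mul, mul_add, mul_add, tail_mul_tail_of_commRel h, h₁,
      mul_comm (tail δ v b), h₂, h₄, hb]
    simp only [map_add, map_mul]
    ring
  obtain ⟨r, hr⟩ := key
  have ho := HahnSeries.order_mul hb₀ hf₀
  have hne := HahnSeries.coeff_order_eq_zero.not.2 (mul_ne_zero hb₀ hf₀)
  rw [ho, hr, coeff_polyIncl, hbn, hfm] at hne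
  by_contra hlt
  rw [if_neg (by omega)] at hne
  exact hne rfl

end Duality

section Existence

variable {R M N : Type*} [CommRing R] [IsDomain R] [AddCommGroup M] [Module R M]
  [AddCommGroup N] [Module R N]

theorem exists_dual_apply_ne_zero [Module.Finite R M] (m : M) (hm : ∀ r : R, r • m = 0 → r = 0) :
    ∃ f : M →ₗ[R] R, f m ≠ 0 := by
  let K := FractionRing R
  let ι := LocalizedModule.mkLinearMap (nonZeroDivisors R) M
  have hx : ι m ≠ 0 := fun h => by
    obtain ⟨s, hs⟩ := (IsLocalizedModule.eq_zero_iff (nonZeroDivisors R) ι).1 h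
    exact nonZeroDivisors.ne_zero s.2 (hm s hs)
  obtain ⟨g, hg⟩ := Module.Projective.exists_dual_ne_zero K hx
  let φ : M →ₗ[R] K := g.restrictScalars R ∘ₗ ι
  obtain ⟨s, hs⟩ := (Module.Finite.fg_top : (⊤ : Submodule R M).FG)
  obtain ⟨b, hb⟩ := IsLocalization.exist_integer_multiples (nonZeroDivisors R) s φ
  have hrange : ∀ y, ((b : R) • φ) y ∈ LinearMap.range (Algebra.linearMap R K) := by
    have : (⊤ : Submodule R M) ≤
        (LinearMap.range (Algebra.linearMap R K)).comap ((b : R) • φ) := by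
      rw [← hs, Submodule.span_le]
      intro y hy
      exact hb y hy
    exact fun y => this Submodule.mem_top
  have hinj : Function.Injective (Algebra.linearMap R K) := IsFractionRing.injective R K
  let f : M →ₗ[R] R := (LinearEquiv.ofInjective _ hinj).symm.toLinearMap ∘ₗ
    ((b : R) • φ).codRestrict _ hrange
  refine ⟨f, fun h => ?_⟩
  have h' : ((b : R) • φ).codRestrict _ hrange m = 0 :=
    (LinearEquiv.ofInjective _ hinj).symm.map_eq_zero_iff.1 h
  have h'' : (b : R) • φ m = 0 := congrArg Subtype.val h'
  rcases smul_eq_zero.1 h'' with h | h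
  · exact nonZeroDivisors.ne_zero b.2 h
  · exact hg h

theorem exists_smul_eq_comp [Module.Finite R N] (L : M →ₗ[R] N) (t : M →ₗ[R] R)
    (h : ∀ x, L x = 0 → t x = 0) :
    ∃ s : R, s ≠ 0 ∧ ∃ g : N →ₗ[R] R, ∀ x, s * t x = g (L x) := by
  let P := LinearMap.range (L.prod (-t))
  obtain ⟨f, hf⟩ := exists_dual_apply_ne_zero (P.mkQ (0, 1)) (fun r hr => by
    rw [← map_smul, Submodule.mkQ_apply, Submodule.Quotient.mk_eq_zero] at hr
    obtain ⟨x, hx⟩ := hr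
    have h₁ : L x = 0 := by simpa using congrArg Prod.fst hx
    have h₂ : -t x = r := by simpa using congrArg Prod.snd hx
    rw [← h₂, h x h₁, neg_zero])
  refine ⟨f (P.mkQ (0, 1)), hf, f ∘ₗ P.mkQ ∘ₗ LinearMap.inl R N R, fun x => ?_⟩
  have hx : P.mkQ (L x, -t x) = 0 := by
    rw [Submodule.mkQ_apply, Submodule.Quotient.mk_eq_zero]
    exact ⟨x, rfl⟩
  have hs : (L x, -t x) = LinearMap.inl R N R (L x) - t x • ((0, 1) : N × R) := by simp
  rw [hs, map_sub, map_smul, sub_eq_zero] at hx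
  rw [LinearMap.comp_apply, LinearMap.comp_apply, hx, map_smul, smul_eq_mul, mul_comm]

variable {d v : Module.End R M} {δ : M →ₗ[R] R} {e : M}

theorem exists_hasDeg [Module.Finite R M] (d v : Module.End R M) (δ : M →ₗ[R] R) (e : M) :
    (∃ n, HasDeg d v δ e n) ∧ ∃ n, HasDegDual d v δ e n := by
  obtain ⟨p, hp, hpv⟩ := LinearMap.exists_monic_and_aeval_eq_zero R v
  have hne : polyIncl R p ≠ 0 := fun h => by
    have := coeff_polyIncl p (-p.natDegree)
    rw [h, if_pos (by omega), Int.natAbs_neg, Int.natAbs_natCast, hp.coeff_natDegree] at this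
    simp at this
  refine ⟨exists_hasDeg_of_ne_zero (z := (0, p)) (by simp [hpv]) (by simpa using hne),
    exists_hasDeg_of_ne_zero (z := (0, p)) ?_ (by simpa using hne)⟩
  ext x
  simp [aeval_dualMap_apply, hpv]

theorem hasDegDual_of_forall_le [Module.Finite R M] {n : ℤ}
    (h : ∀ k, HasDeg d v δ e k → n ≤ k) : HasDegDual d v δ e (-n) := by
  have hlt : ∀ k < n, ¬ HasDeg d v δ e k := fun k hk hd => not_le.2 hk (h k hd)
  rcases lt_or_ge 0 n with hn | hn
  · obtain ⟨K, rfl⟩ : ∃ K : ℕ, n = K + 1 := ⟨(n - 1).toNat, by omega⟩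
    let P := LinearMap.range d ⊔
      (degreeLT R K).map (LinearMap.applyₗ e ∘ₗ (aeval v).toLinearMap)
    obtain ⟨f, hf⟩ := exists_dual_apply_ne_zero (P.mkQ ((v ^ K) e)) (fun r hr => by
      by_contra hr₀
      rw [← map_smul, Submodule.mkQ_apply, Submodule.Quotient.mk_eq_zero] at hr
      obtain ⟨_, ⟨b, rfl⟩, _, ⟨p, hp, rfl⟩, hbp⟩ := Submodule.mem_sup.1 hr
      have hpc : ∀ i, K ≤ i → p.coeff i = 0 := fun i hi =>
        coeff_eq_zero_of_degree_lt ((mem_degreeLT.1 hp).trans_le (by exact_mod_cast hi))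
      refine hlt K (by omega) (hasDeg_of_coeff (z := (b, C r * X ^ K - p)) ?_ ?_ ?_)
      · rw [bdry_mk, sub_eq_zero, map_sub, LinearMap.sub_apply, eq_sub_iff_add_eq]
        simpa using hbp
      · rw [coeff_laurent, if_neg (by omega)]
        simpa [hpc] using hr₀
      · intro m hm
        rw [coeff_laurent, if_neg (by omega), coeff_sub, coeff_C_mul_X_pow, if_neg (by omega),
          hpc _ (by omega), sub_zero])
    have hP : ∀ y ∈ P, f (P.mkQ y) = 0 := fun y hy => by
      rw [Submodule.mkQ_apply, (Submodule.Quotient.mk_eq_zero P).2 hy, map_zero]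
    refine hasDeg_of_coeff (z := (f ∘ₗ P.mkQ, 0)) ?_ ?_ ?_
    · ext x
      simpa using hP _ (Submodule.mem_sup_left ⟨x, rfl⟩)
    · rw [coeff_laurent, if_pos (by omega), Module.Dual.eval_apply, dualMap_pow_apply,
        show (- -((K : ℤ) + 1) - 1).toNat = K by omega]
      exact hf
    · intro m hm
      rw [coeff_laurent]
      split_ifs with h₀
      · rw [Module.Dual.eval_apply, dualMap_pow_apply]
        refine hP _ (Submodule.mem_sup_right ⟨X ^ (m - 1).toNat, mem_degreeLT.2 ?_, by simp⟩)
        rw [degree_X_pow]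
        exact_mod_cast (by omega)
      · simp
  · obtain ⟨K, rfl⟩ : ∃ K : ℕ, n = -K := ⟨(-n).toNat, by omega⟩
    let L : M →ₗ[R] M × (Fin K → R) := d.prod (LinearMap.pi fun i => δ ∘ₗ v ^ (i : ℕ))
    obtain ⟨s, hs, g, hg⟩ := exists_smul_eq_comp L (δ ∘ₗ v ^ K) (fun b hb => by
      have hdb : d b = 0 := congrArg Prod.fst hb
      have hδ : ∀ i < K, δ ((v ^ i) b) = 0 := fun i hi => congrFun (congrArg Prod.snd hb) ⟨i, hi⟩
      by_contra hne
      refine hlt (-K - 1) (by omega) (hasDeg_of_coeff (z := (b, 0)) (by simp [hdb]) ?_ ?_)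
      · rw [coeff_laurent, if_pos (by omega), show (-(-(K : ℤ) - 1) - 1).toNat = K by omega]
        exact hne
      · intro m hm
        rw [coeff_laurent]
        split_ifs with h₀
        · exact hδ _ (by omega)
        · simp)
    let c : Fin K → R := fun i => g (0, Pi.single i 1)
    let q : R[X] := C s * X ^ K - ∑ i : Fin K, C (c i) * X ^ (i : ℕ)
    have hq : ∀ i, K < i → q.coeff i = 0 := fun i hi => by
      simp only [q, coeff_sub, finsetSum_coeff, coeff_C_mul_X_pow]
      rw [if_neg hi.ne', Finset.sum_eq_zero, sub_zero]
      intro j _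
      rw [if_neg (by omega)]
    have hqK : q.coeff K = s := by
      simp only [q, coeff_sub, finsetSum_coeff, coeff_C_mul_X_pow]
      rw [if_pos trivial, Finset.sum_eq_zero, sub_zero]
      intro j _
      rw [if_neg (by omega)]
    refine hasDeg_of_coeff (z := (-(g ∘ₗ LinearMap.inl R M (Fin K → R)), q)) ?_ ?_ ?_
    · ext x
      have hx : s * δ ((v ^ K) x) = g (d x, fun i => δ ((v ^ (i : ℕ)) x)) := hg x
      have hsplit : ((d x, fun i => δ ((v ^ (i : ℕ)) x)) : M × (Fin K → R)) =
          LinearMap.inl R M (Fin K → R) (d x) + ∑ i : Fin K, δ ((v ^ (i : ℕ)) x) •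
            ((0, Pi.single i 1) : M × (Fin K → R)) := by
        refine Prod.ext (by simp [Prod.fst_sum]) ?_
        ext j
        simp [Prod.snd_sum, Finset.sum_apply, Pi.single_apply]
      rw [hsplit, map_add, map_sum] at hx
      simp only [map_smul, smul_eq_mul] at hx
      rw [bdry_mk, LinearMap.sub_apply, aeval_dualMap_apply]
      simp only [q, map_sub, map_sum, map_mul, aeval_C, aeval_X_pow, LinearMap.sub_apply,
        LinearMap.sum_apply, Module.End.mul_apply, Module.algebraMap_end_apply, map_smul,
        smul_eq_mul, hx]
      simp [c, mul_comm]
    · rw [coeff_laurent, if_neg (by omega)]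
      simpa [hqK] using hs
    · intro m hm
      rw [coeff_laurent, if_neg (by omega), hq _ (by omega)]

/-- The least degree of a cycle, certified by a cycle of the dual complex. -/
def IsMinDeg (d v : Module.End R M) (δ : M →ₗ[R] R) (e : M) (n : ℤ) : Prop :=
  HasDeg d v δ e n ∧ HasDegDual d v δ e (-n)

theorem IsMinDeg.isLeast (h : CommRel d v δ e) {n : ℤ} (hn : IsMinDeg d v δ e n) :
    IsLeast {k | HasDeg d v δ e k} n :=
  ⟨hn.1, fun k hk => by have := HasDeg.add_nonneg h hk hn.2; omega⟩

theorem exists_isMinDeg [Module.Finite R M] (h : CommRel d v δ e) : ∃ n, IsMinDeg d v δ e n := by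
  obtain ⟨⟨a, ha⟩, b, hb⟩ := exists_hasDeg d v δ e
  obtain ⟨n, hn, hle⟩ := Int.exists_least_of_bdd (P := HasDeg d v δ e)
    ⟨-b, fun k hk => by have := HasDeg.add_nonneg h hk hb; omega⟩ ⟨a, ha⟩
  exact ⟨n, hn, hasDegDual_of_forall_le hle⟩

end Existence

section Tensor

variable {R M N : Type*} [CommRing R] [AddCommGroup M] [Module R M] [AddCommGroup N] [Module R N]

/-- The relations among the structure maps of an S-complex with sign map `ε`. -/
structure SignedRel (d v ε : Module.End R M) (δ : M →ₗ[R] R) (e : M) : Prop where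
  comm : CommRel d v δ e
  δ_d : ∀ x, δ (d x) = 0
  d_e : d e = 0
  ε_v : ∀ x, ε (v x) = v (ε x)
  δ_ε : ∀ x, δ (ε x) = -δ x
  ε_e : ε e = e
  δ_pow : ∀ k, δ ((v ^ k) e) = 0

/-- The module `(M ⊗ N) ⊕ (M ⊗ N) ⊕ M ⊕ N`. -/
abbrev Ten (R M N : Type*) [CommRing R] [AddCommGroup M] [Module R M] [AddCommGroup N]
    [Module R N] : Type _ := (M ⊗[R] N) × (M ⊗[R] N) × M × N

/-- The map `δ ⊗ 1`. -/
noncomputable def contractLeft (N : Type*) [AddCommGroup N] [Module R N] (δ : M →ₗ[R] R) :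
    M ⊗[R] N →ₗ[R] N :=
  (TensorProduct.lid R N).toLinearMap ∘ₗ TensorProduct.map δ LinearMap.id

@[simp]
theorem contractLeft_tmul (δ : M →ₗ[R] R) (x : M) (y : N) :
    contractLeft N δ (x ⊗ₜ y) = δ x • y := by simp [contractLeft]

/-- The map `ε ⊗ δ`. -/
noncomputable def contractRight (ε : Module.End R M) (δ : N →ₗ[R] R) : M ⊗[R] N →ₗ[R] M :=
  (TensorProduct.rid R M).toLinearMap ∘ₗ TensorProduct.map ε δ

@[simp]
theorem contractRight_tmul (ε : Module.End R M) (δ : N →ₗ[R] R) (x : M) (y : N) :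
    contractRight ε δ (x ⊗ₜ y) = δ y • ε x := by simp [contractRight]

/-- The map `v` of a tensor product. -/
noncomputable def tenV (v : Module.End R M) (δ : M →ₗ[R] R) (e : M) (v' : Module.End R N) :
    Module.End R (Ten R M N) where
  toFun x := (TensorProduct.map v LinearMap.id x.1 + e ⊗ₜ x.2.2.2,
    TensorProduct.map v LinearMap.id x.2.1, v x.2.2.1, contractLeft N δ x.2.1 + v' x.2.2.2)
  map_add' x y := by
    ext <;> simp [TensorProduct.tmul_add] <;> abel
  map_smul' r x := by
    ext <;> simp

/-- The differential of a tensor product. -/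
noncomputable def tenD (d v ε : Module.End R M) (δ : M →ₗ[R] R) (e : M)
    (d' v' : Module.End R N) (δ' : N →ₗ[R] R) (e' : N) : Module.End R (Ten R M N) where
  toFun x := (TensorProduct.map d LinearMap.id x.1 + TensorProduct.map ε d' x.1,
    TensorProduct.map ε v' x.1 - TensorProduct.map (ε ∘ₗ v) LinearMap.id x.1 +
      (TensorProduct.map d LinearMap.id x.2.1 - TensorProduct.map ε d' x.2.1) +
      ε x.2.2.1 ⊗ₜ e' - e ⊗ₜ x.2.2.2,
    contractRight ε δ' x.1 + d x.2.2.1, contractLeft N δ x.1 + d' x.2.2.2)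
  map_add' x y := by
    ext <;> simp [TensorProduct.tmul_add, TensorProduct.add_tmul] <;> abel
  map_smul' r x := by
    ext <;> simp [smul_add, smul_sub, TensorProduct.smul_tmul']

/-- The map `δ₁` of a tensor product. -/
noncomputable def tenδ (δ : M →ₗ[R] R) (δ' : N →ₗ[R] R) : Ten R M N →ₗ[R] R where
  toFun x := δ x.2.2.1 + δ' x.2.2.2
  map_add' x y := by simp; abel
  map_smul' r x := by simp [mul_add]

/-- The element `δ₂(1)` of a tensor product. -/
def tenE (R : Type*) [CommRing R] [Module R M] [Module R N] (e : M) (e' : N) : Ten R M N :=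
  (0, 0, e, e')

variable (d v ε : Module.End R M) (δ : M →ₗ[R] R) (e : M)
    (d' v' ε' : Module.End R N) (δ' : N →ₗ[R] R) (e' : N)

@[simp]
theorem tenV_mk (x₁ x₂ : M ⊗[R] N) (x₃ : M) (x₄ : N) :
    tenV v δ e v' (x₁, x₂, x₃, x₄) = (TensorProduct.map v LinearMap.id x₁ + e ⊗ₜ x₄,
      TensorProduct.map v LinearMap.id x₂, v x₃, contractLeft N δ x₂ + v' x₄) := rfl

@[simp]
theorem tenD_mk (x₁ x₂ : M ⊗[R] N) (x₃ : M) (x₄ : N) :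
    tenD d v ε δ e d' v' δ' e' (x₁, x₂, x₃, x₄) =
      (TensorProduct.map d LinearMap.id x₁ + TensorProduct.map ε d' x₁,
        TensorProduct.map ε v' x₁ - TensorProduct.map (ε ∘ₗ v) LinearMap.id x₁ +
          (TensorProduct.map d LinearMap.id x₂ - TensorProduct.map ε d' x₂) + ε x₃ ⊗ₜ e' - e ⊗ₜ x₄,
        contractRight ε δ' x₁ + d x₃, contractLeft N δ x₁ + d' x₄) := rfl

@[simp]
theorem tenδ_mk (x₁ x₂ : M ⊗[R] N) (x₃ : M) (x₄ : N) :
    tenδ δ δ' (x₁, x₂, x₃, x₄) = δ x₃ + δ' x₄ := rfl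

/-- Linear maps out of `Ten R M N` agree when they agree on generators. -/
theorem Ten.hom_ext {P : Type*} [AddCommGroup P] [Module R P] {f g : Ten R M N →ₗ[R] P}
    (h₁ : ∀ x y, f (x ⊗ₜ y, 0, 0, 0) = g (x ⊗ₜ y, 0, 0, 0))
    (h₂ : ∀ x y, f (0, x ⊗ₜ y, 0, 0) = g (0, x ⊗ₜ y, 0, 0))
    (h₃ : ∀ x, f (0, 0, x, 0) = g (0, 0, x, 0)) (h₄ : ∀ y, f (0, 0, 0, y) = g (0, 0, 0, y)) :
    f = g := by
  ext x y
  · exact h₁ x y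
  · exact h₂ x y
  · exact h₃ x
  · exact h₄ x

variable {d v ε δ e d' v' ε' δ' e'}

theorem tenD_commRel (h : SignedRel d v ε δ e) (h' : CommRel d' v' δ' e') :
    CommRel (tenD d v ε δ e d' v' δ' e') (tenV v δ e v') (tenδ δ δ') (tenE R e e') := by
  have key : tenD d v ε δ e d' v' δ' e' ∘ₗ tenV v δ e v' =
      tenV v δ e v' ∘ₗ tenD d v ε δ e d' v' δ' e' +
        (LinearMap.toSpanSingleton R _ (tenE R e e')) ∘ₗ tenδ δ δ' := by
    have h₀ : δ e = 0 := h.δ_pow 0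
    have h₁ := h.comm
    have h₂ : ∀ x, δ (v (ε x)) = -δ (v x) := fun x => by rw [← h.ε_v, h.δ_ε]
    unfold CommRel at h₁ h'
    refine Ten.hom_ext (fun x y => ?_) (fun x y => ?_) (fun x => ?_) (fun y => ?_) <;>
    · simp [tenE, h₀, h₁, h₂, h', h.δ_d, h.d_e, h.ε_v, h.δ_ε, h.ε_e, TensorProduct.add_tmul,
        TensorProduct.smul_tmul', TensorProduct.tmul_smul]
      try abel
  exact fun x => LinearMap.congr_fun key x

theorem pow_tenV_third (k : ℕ) (x : M) :
    (tenV v δ e v' ^ k) (0, 0, x, (0 : N)) = (0, 0, (v ^ k) x, 0) := by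
  induction k generalizing x with
  | zero => rfl
  | succ k ih => rw [pow_succ, Module.End.mul_apply, tenV_mk]; simp [ih, pow_succ]

theorem aeval_tenV_third (p : R[X]) (x : M) :
    aeval (tenV v δ e v') p (0, 0, x, (0 : N)) = (0, 0, aeval v p x, 0) := by
  let f : M →ₗ[R] Ten R M N := LinearMap.inr R _ _ ∘ₗ LinearMap.inr R _ _ ∘ₗ LinearMap.inl R M N
  exact (map_aeval (w := tenV v δ e v') f (fun x => by simp [f]) p x).symm

theorem aeval_tenV_first (p : R[X]) (t : M ⊗[R] N) :
    aeval (tenV v δ e v') p (t, 0, 0, 0) =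
      (aeval (TensorProduct.map v LinearMap.id : Module.End R (M ⊗[R] N)) p t, 0, 0, 0) := by
  let f : M ⊗[R] N →ₗ[R] Ten R M N := LinearMap.inl R _ _
  refine (map_aeval (w := tenV v δ e v') f (fun x => ?_) p t).symm
  change (_, 0, 0, 0) = tenV v δ e v' (x, 0, 0, 0)
  simp

theorem aeval_map_id_tmul (p : R[X]) (x : M) (y : N) :
    aeval (TensorProduct.map v LinearMap.id : Module.End R (M ⊗[R] N)) p (x ⊗ₜ y) =
      aeval v p x ⊗ₜ y :=
  (map_aeval ((TensorProduct.mk R M N).flip y) (fun x => by simp) p x).symm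

theorem aeval_tenV_second (h : SignedRel d v ε δ e) (p : R[X]) (y : N) :
    aeval (tenV v δ e v') p (0, e ⊗ₜ y, 0, 0) = (0, aeval v p e ⊗ₜ y, 0, 0) := by
  let f : M →ₗ[R] Ten R M N :=
    LinearMap.inr R _ _ ∘ₗ LinearMap.inl R _ _ ∘ₗ (TensorProduct.mk R M N).flip y
  refine (map_aeval_of_pow (w := tenV v δ e v') f e _ (fun k => ?_) p).symm
  induction k with
  | zero => rfl
  | succ k ih =>
    rw [pow_succ', pow_succ', Module.End.mul_apply, Module.End.mul_apply, ← ih]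
    change (0, _, 0, 0) = tenV v δ e v' (0, (v ^ k) e ⊗ₜ y, 0, 0)
    simp [h.δ_pow]

/-- The image under `tenD` of the first summand is stable under `tenV`. -/
theorem aeval_tenV_tenD (h : SignedRel d v ε δ e) (h' : CommRel d' v' δ' e') (p : R[X])
    (t : M ⊗[R] N) :
    ∃ s, aeval (tenV v δ e v') p (tenD d v ε δ e d' v' δ' e' (t, 0, 0, 0)) =
      tenD d v ε δ e d' v' δ' e' (s, 0, 0, 0) := by
  let f : M ⊗[R] N →ₗ[R] Ten R M N := tenD d v ε δ e d' v' δ' e' ∘ₗ LinearMap.inl R _ _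
  refine ⟨aeval (TensorProduct.map v LinearMap.id : Module.End R (M ⊗[R] N)) p t,
    (map_aeval f (fun x => ?_) p t).symm⟩
  have := tenD_commRel h h' (x, 0, 0, 0)
  simp only [tenδ_mk, map_zero, add_zero, zero_smul] at this
  change tenD d v ε δ e d' v' δ' e' (TensorProduct.map v LinearMap.id x, 0, 0, 0) =
    tenV v δ e v' (tenD d v ε δ e d' v' δ' e' (x, 0, 0, 0))
  simpa only [tenV_mk, map_zero, tmul_zero, add_zero] using this

/-- The chain-level comparison between the cycle with fourth component `γ` and `β ⊗ γ`. -/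
noncomputable def shiftMap (v ε : Module.End R M) (δ : M →ₗ[R] R) (e : M) (v' : Module.End R N)
    (p : R[X]) (β : M) (γ : N) : Ten R M N :=
  aeval (tenV v δ e v') p (0, 0, 0, γ) - (0, ε β ⊗ₜ γ, 0, 0)

theorem shiftMap_add (p : R[X]) (β : M) (γ₁ γ₂ : N) :
    shiftMap v ε δ e v' p β (γ₁ + γ₂) =
      shiftMap v ε δ e v' p β γ₁ + shiftMap v ε δ e v' p β γ₂ := by
  have h₁ : ((0, 0, 0, γ₁ + γ₂) : Ten R M N) = (0, 0, 0, γ₁) + (0, 0, 0, γ₂) := by simp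
  have h₂ : ((0, ε β ⊗ₜ (γ₁ + γ₂), 0, 0) : Ten R M N) =
      (0, ε β ⊗ₜ γ₁, 0, 0) + (0, ε β ⊗ₜ γ₂, 0, 0) := by simp [tmul_add]
  rw [shiftMap, h₁, h₂, map_add]
  simp only [shiftMap]
  abel

theorem shiftMap_apply_v (h : SignedRel d v ε δ e) {p : R[X]} {β : M}
    (hβ : d β = aeval v p e) {γ : N} (hd : d' γ = 0) (hδ : δ' γ = 0) :
    shiftMap v ε δ e v' p β (v' γ) = tenV v δ e v' (shiftMap v ε δ e v' p β γ) -
      tenD d v ε δ e d' v' δ' e' (β ⊗ₜ γ, 0, 0, 0) := by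
  have h₁ : ((0, 0, 0, v' γ) : Ten R M N) = tenV v δ e v' (0, 0, 0, γ) - (e ⊗ₜ γ, 0, 0, 0) := by
    simp
  have h₂ : aeval (tenV v δ e v') p (tenV v δ e v' (0, 0, 0, γ)) =
      tenV v δ e v' (aeval (tenV v δ e v') p (0, 0, 0, γ)) :=
    (map_aeval (tenV v δ e v') (fun _ => rfl) p _).symm
  rw [shiftMap, shiftMap, h₁, map_sub, map_sub, h₂, aeval_tenV_first, aeval_map_id_tmul, ← hβ]
  simp [hd, hδ, h.ε_v, h.δ_ε, sub_sub]

theorem exists_shiftMap_aeval (h : SignedRel d v ε δ e) (h' : CommRel d' v' δ' e') {p : R[X]}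
    {β : M} (hβ : d β = aeval v p e) (q : R[X]) {γ : N} (hd : d' γ = 0)
    (hδ : ∀ k, δ' ((v' ^ k) γ) = 0) :
    ∃ s, shiftMap v ε δ e v' p β (aeval v' q γ) =
      aeval (tenV v δ e v') q (shiftMap v ε δ e v' p β γ) +
        tenD d v ε δ e d' v' δ' e' (s, 0, 0, 0) := by
  induction q using Polynomial.induction_on generalizing γ with
  | C a =>
    refine ⟨0, ?_⟩
    have h₀ : ((0, 0, 0, a • γ) : Ten R M N) = a • (0, 0, 0, γ) := by simp
    simp only [shiftMap, aeval_C, Module.algebraMap_end_apply, h₀, map_smul]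
    simp [smul_sub]
  | add q₁ q₂ ih₁ ih₂ =>
    obtain ⟨s₁, h₁⟩ := ih₁ hd hδ
    obtain ⟨s₂, h₂⟩ := ih₂ hd hδ
    refine ⟨s₁ + s₂, ?_⟩
    have hs : ((s₁ + s₂, 0, 0, 0) : Ten R M N) = (s₁, 0, 0, 0) + (s₂, 0, 0, 0) := by simp
    rw [hs, map_add (tenD _ _ _ _ _ _ _ _ _), map_add, LinearMap.add_apply, shiftMap_add, h₁, h₂,
      map_add, LinearMap.add_apply]
    abel
  | monomial k a ih =>
    have hδγ : δ' γ = 0 := hδ 0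
    obtain ⟨s₁, h₁⟩ := ih (γ := v' γ) (by rw [h', hd, hδγ, map_zero, zero_smul, add_zero])
      (fun k => by simpa only [pow_succ, Module.End.mul_apply] using hδ (k + 1))
    obtain ⟨s₂, h₂⟩ := aeval_tenV_tenD (ε := ε) (d' := d') (δ' := δ') (e' := e') h h'
      (C a * X ^ k) (β ⊗ₜ γ)
    refine ⟨s₁ - s₂, ?_⟩
    have hs : ((s₁ - s₂, 0, 0, 0) : Ten R M N) = (s₁, 0, 0, 0) - (s₂, 0, 0, 0) := by simp
    rw [hs, map_sub, ← h₂, pow_succ, ← mul_assoc, map_mul _ _ X, map_mul _ _ X, aeval_X, aeval_X,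
      Module.End.mul_apply, Module.End.mul_apply, h₁, shiftMap_apply_v h hβ hd hδγ, map_sub]
    abel

theorem exists_pow_tenV_first_fourth (k : ℕ) (t : M ⊗[R] N) (y : N) :
    ∃ a, (tenV v δ e v' ^ k) (t, 0, 0, y) = (a, 0, 0, (v' ^ k) y) := by
  induction k with
  | zero => exact ⟨t, rfl⟩
  | succ k ih =>
    obtain ⟨a, ha⟩ := ih
    refine ⟨TensorProduct.map v LinearMap.id a + e ⊗ₜ (v' ^ k) y, ?_⟩
    rw [pow_succ', Module.End.mul_apply, ha, tenV_mk, pow_succ', Module.End.mul_apply]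
    simp

theorem exists_pow_tenV_second (k : ℕ) (x : M) (y : N) :
    ∃ a, (tenV v δ e v' ^ (k + 1)) (0, x ⊗ₜ y, 0, 0) = (a, (v ^ (k + 1)) x ⊗ₜ y, 0,
      ∑ ij ∈ Finset.HasAntidiagonal.antidiagonal k, δ ((v ^ ij.1) x) • (v' ^ ij.2) y) := by
  induction k with
  | zero => exact ⟨0, by simp⟩
  | succ k ih =>
    obtain ⟨a, ha⟩ := ih
    refine ⟨TensorProduct.map v LinearMap.id a + e ⊗ₜ
      ∑ ij ∈ Finset.HasAntidiagonal.antidiagonal k, δ ((v ^ ij.1) x) • (v' ^ ij.2) y, ?_⟩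
    rw [pow_succ', Module.End.mul_apply, ha, tenV_mk, Finset.Nat.sum_antidiagonal_succ']
    simp only [TensorProduct.map_tmul, contractLeft_tmul, LinearMap.id_apply, map_sum, map_smul,
      map_zero, pow_zero, Module.End.one_apply, pow_succ', Module.End.mul_apply]

theorem tail_tenV_second (x : M) (y : N) :
    tail (tenδ δ δ') (tenV v δ e v') (0, x ⊗ₜ y, 0, 0) = tail δ v x * tail δ' v' y := by
  rw [tail_mul_tail δ v x δ' v' y
    (fun k => tenδ δ δ' ((tenV v δ e v' ^ k) (0, x ⊗ₜ y, 0, 0))) (by simp), tail_apply]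
  intro k
  obtain ⟨a, ha⟩ := exists_pow_tenV_second (v := v) (δ := δ) (e := e) (v' := v') k x y
  rw [ha]
  simp

theorem tail_tenV_third (x : M) :
    tail (tenδ δ δ') (tenV v δ e v') (0, 0, x, (0 : N)) = tail δ v x :=
  tail_congr fun k => by rw [pow_tenV_third]; simp

theorem tail_tenV_first_fourth (t : M ⊗[R] N) (y : N) :
    tail (tenδ δ δ') (tenV v δ e v') (t, 0, 0, y) = tail δ' v' y :=
  tail_congr fun k => by
    obtain ⟨a, ha⟩ := exists_pow_tenV_first_fourth (v := v) (δ := δ) (e := e) (v' := v') k t y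
    rw [ha]
    simp

theorem HasDeg.tensor [IsDomain R] (h : SignedRel d v ε δ e) (h' : SignedRel d' v' ε' δ' e')
    {n m : ℤ} (hn : HasDeg d v δ e n) (hm : HasDeg d' v' δ' e' m) :
    HasDeg (tenD d v ε δ e d' v' δ' e') (tenV v δ e v') (tenδ δ δ') (tenE R e e') (n + m) := by
  obtain ⟨⟨β, p⟩, hβ, hβ₀, hβn⟩ := hn
  obtain ⟨⟨β', p'⟩, hβ', hβ'₀, hβ'm⟩ := hm
  rw [bdry_mk, sub_eq_zero] at hβ hβ'
  obtain ⟨z₁, h₁, h₁'⟩ := exists_poly_mul (tenD_commRel h h'.comm) p' ((0, 0, β, 0), p)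
  obtain ⟨z₂, h₂, h₂'⟩ := exists_poly_mul (tenD_commRel h h'.comm) p ((0, 0, 0, β'), 0)
  obtain ⟨s, hs⟩ := exists_shiftMap_aeval h h'.comm hβ p' h'.d_e h'.δ_pow
  have hz₁ : bdry (tenD d v ε δ e d' v' δ' e') (tenV v δ e v') (tenE R e e') ((0, 0, β, 0), p) =
      -shiftMap v ε δ e v' p β e' := by
    have hE : tenE R e e' = (0, 0, e, 0) + (0, 0, 0, e') := by simp [tenE]
    rw [bdry_mk, hE, map_add, aeval_tenV_third, shiftMap, ← hβ, tenD_mk, ← sub_sub, neg_sub]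
    congr 1
    simp
    rfl
  have hz₂ : aeval (tenV v δ e v') p (bdry (tenD d v ε δ e d' v' δ' e') (tenV v δ e v')
      (tenE R e e') ((0, 0, 0, β'), 0)) + tenD d v ε δ e d' v' δ' e' (0, β ⊗ₜ β', 0, 0) =
      shiftMap v ε δ e v' p β (d' β') := by
    have hE : tenD d v ε δ e d' v' δ' e' (0, 0, 0, β') = (0, 0, 0, d' β') - (0, e ⊗ₜ β', 0, 0) := by
      simp
    rw [bdry_mk, map_zero, LinearMap.zero_apply, sub_zero, hE, map_sub, aeval_tenV_second h, ← hβ,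
      shiftMap, sub_add]
    congr 1
    simp
    rfl
  let z := z₁ + z₂ + ((0, β ⊗ₜ β', 0, 0), 0) + ((-s, 0, 0, 0), 0)
  have hlz : laurent (tenV v δ e v') (tenδ δ δ') z =
      laurent v δ (β, p) * laurent v' δ' (β', p') := by
    simp only [z, map_add, h₁', h₂', laurent_mk, tail_tenV_second, tail_tenV_third,
      tail_tenV_first_fourth, map_zero]
    ring
  refine ⟨z, ?_, ?_, ?_⟩
  · have hneg : ((-s, 0, 0, 0) : Ten R M N) = -(s, 0, 0, 0) := by simp
    have h₀ : ∀ x, bdry (tenD d v ε δ e d' v' δ' e') (tenV v δ e v') (tenE R e e') (x, 0) =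
        tenD d v ε δ e d' v' δ' e' x := fun x => by simp
    rw [h₀] at hz₂
    simp only [z, map_add]
    rw [h₁, h₂, hz₁, h₀, h₀, h₀, map_neg, hneg, map_neg, add_assoc (-_), hz₂, hβ', hs]
    abel
  · rw [hlz]
    exact mul_ne_zero hβ₀ hβ'₀
  · rw [hlz, HahnSeries.order_mul hβ₀ hβ'₀, hβn, hβ'm]
    ring

theorem SignedRel.dual (h : SignedRel d v ε δ e) :
    SignedRel (-d.dualMap : Module.End R (Module.Dual R M)) v.dualMap (-ε.dualMap)
      (Module.Dual.eval R M e) δ where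
  comm f := by
    ext x
    have := h.comm x
    simp [this, mul_comm]
  δ_d f := by simp [h.d_e]
  d_e := by ext x; simp [h.δ_d]
  ε_v f := by ext x; simp [h.ε_v]
  δ_ε f := by simp [h.ε_e]
  ε_e := by ext x; simp [h.δ_ε]
  δ_pow k := by
    rw [Module.Dual.eval_apply, dualMap_pow_apply]
    exact h.δ_pow k

/-- The comparison map from the tensor product of the duals to the dual of the tensor product;
it interchanges the first two summands. -/
noncomputable def tenDual (R M N : Type*) [CommRing R] [AddCommGroup M] [Module R M]
    [AddCommGroup N] [Module R N] :
    Ten R (Module.Dual R M) (Module.Dual R N) →ₗ[R] Module.Dual R (Ten R M N) :=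
  LinearMap.coprod
    ((LinearMap.fst R _ _ ∘ₗ LinearMap.snd R (M ⊗[R] N) _).dualMap ∘ₗ
      TensorProduct.dualDistrib R M N)
    (LinearMap.coprod ((LinearMap.fst R _ _).dualMap ∘ₗ TensorProduct.dualDistrib R M N)
      (LinearMap.coprod
        (LinearMap.fst R _ _ ∘ₗ LinearMap.snd R _ _ ∘ₗ LinearMap.snd R _ _).dualMap
        (LinearMap.snd R _ _ ∘ₗ LinearMap.snd R _ _ ∘ₗ LinearMap.snd R _ _).dualMap))

@[simp]
theorem tenDual_apply (y₁ y₂ : Module.Dual R M ⊗[R] Module.Dual R N) (y₃ : Module.Dual R M)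
    (y₄ : Module.Dual R N) (x₁ x₂ : M ⊗[R] N) (x₃ : M) (x₄ : N) :
    tenDual R M N (y₁, y₂, y₃, y₄) (x₁, x₂, x₃, x₄) = TensorProduct.dualDistrib R M N y₁ x₂ +
      (TensorProduct.dualDistrib R M N y₂ x₁ + (y₃ x₃ + y₄ x₄)) := rfl

theorem tenDual_tenV (y : Ten R (Module.Dual R M) (Module.Dual R N)) :
    tenDual R M N (tenV (v.dualMap : Module.End R (Module.Dual R M)) (Module.Dual.eval R M e) δ
      v'.dualMap y) = (tenV v δ e v').dualMap (tenDual R M N y) := by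
  refine LinearMap.congr_fun (f := tenDual R M N ∘ₗ tenV (v.dualMap : Module.End R _)
    (Module.Dual.eval R M e) δ v'.dualMap) (g := (tenV v δ e v').dualMap ∘ₗ tenDual R M N) ?_ y
  refine Ten.hom_ext (fun f g => ?_) (fun f g => ?_) (fun f => ?_) (fun g => ?_) <;>
  refine Ten.hom_ext (fun x y => ?_) (fun x y => ?_) (fun x => ?_) (fun y => ?_) <;>
  simp

theorem tenDual_tenD (h : SignedRel d v ε δ e) (y : Ten R (Module.Dual R M) (Module.Dual R N)) :
    tenDual R M N (tenD (-d.dualMap : Module.End R (Module.Dual R M)) v.dualMap (-ε.dualMap)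
      (Module.Dual.eval R M e) δ (-d'.dualMap : Module.End R (Module.Dual R N)) v'.dualMap
      (Module.Dual.eval R N e') δ' y) =
    (-(tenD d v ε δ e d' v' δ' e').dualMap : Module.End R (Module.Dual R (Ten R M N)))
      (tenDual R M N y) := by
  refine LinearMap.congr_fun (f := tenDual R M N ∘ₗ tenD (-d.dualMap : Module.End R _) v.dualMap
      (-ε.dualMap) (Module.Dual.eval R M e) δ (-d'.dualMap : Module.End R _) v'.dualMap
      (Module.Dual.eval R N e') δ')
    (g := (-(tenD d v ε δ e d' v' δ' e').dualMap : Module.End R _) ∘ₗ tenDual R M N) ?_ y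
  refine Ten.hom_ext (fun f g => ?_) (fun f g => ?_) (fun f => ?_) (fun g => ?_) <;>
  refine Ten.hom_ext (fun x y => ?_) (fun x y => ?_) (fun x => ?_) (fun y => ?_) <;>
  · simp [h.ε_v]
    try ring

theorem IsMinDeg.tensor [IsDomain R] (h : SignedRel d v ε δ e) (h' : SignedRel d' v' ε' δ' e')
    {n m : ℤ} (hn : IsMinDeg d v δ e n) (hm : IsMinDeg d' v' δ' e' m) :
    IsMinDeg (tenD d v ε δ e d' v' δ' e') (tenV v δ e v') (tenδ δ δ') (tenE R e e') (n + m) := by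
  refine ⟨hn.1.tensor h h' hm.1, ?_⟩
  have := HasDeg.map (tenDual R M N) (tenDual_tenD h) tenDual_tenV
    (δ' := Module.Dual.eval R _ (tenE R e e')) (e' := tenδ δ δ') ?_ ?_
    (HasDeg.tensor h.dual h'.dual hn.2 hm.2)
  · rwa [neg_add]
  · rintro ⟨y₁, y₂, y₃, y₄⟩
    simp [tenE]
  · refine LinearMap.ext fun ⟨x₁, x₂, x₃, x₄⟩ => ?_
    simp [tenE]

end Tensor

section Link

open SComplexData

variable {R : Type u} [CommRing R]

theorem IsSComplex.hom_ext {X : SComplexData R} (hX : X.IsSComplex) {P : Type*} [AddCommGroup P]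
    [Module R P] {f g : X.Tot →ₗ[R] P} (h : ∀ i, ∀ x ∈ X.grading i, f x = g x) : f = g := by
  ext x
  have hx : x ∈ ⨆ i, X.grading i := by
    rw [hX.internal.submodule_iSup_eq_top]
    exact Submodule.mem_top
  induction hx using Submodule.iSup_induction' with
  | mem i x hx => exact h i x hx
  | zero => simp
  | add x y _ _ hx hy => rw [map_add, map_add, hx, hy]

theorem IsSComplex.signedRel {X : SComplexData R} (hX : X.IsSComplex) :
    SignedRel X.d X.v X.sign X.δ₁ (X.δ₂ 1) where
  comm x := by
    have h := LinearMap.congr_fun hX.d_v x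
    have h₂ : X.δ₂ (X.δ₁ x) = X.δ₁ x • X.δ₂ 1 := by rw [← map_smul, smul_eq_mul, mul_one]
    simp only [LinearMap.sub_apply, LinearMap.comp_apply, LinearMap.zero_apply, h₂] at h
    rw [← sub_eq_zero, ← h]
    abel
  δ_d x := LinearMap.congr_fun hX.δ₁_d x
  d_e := LinearMap.congr_fun hX.d_δ₂ 1
  ε_v x := by
    refine LinearMap.congr_fun (f := X.sign ∘ₗ X.v) (g := X.v ∘ₗ X.sign)
      (IsSComplex.hom_ext hX fun i x hx => ?_) x
    have hv : X.v x ∈ X.grading (i - 2) := hX.v_deg i ⟨x, hx, rfl⟩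
    rw [LinearMap.comp_apply, LinearMap.comp_apply, hX.sign_spec _ _ hv, hX.sign_spec _ _ hx]
    have : Even (i - 2) ↔ Even i := by simp
    simp only [this]
    split_ifs <;> simp
  δ_ε x := by
    refine LinearMap.congr_fun (f := X.δ₁ ∘ₗ X.sign) (g := -X.δ₁)
      (IsSComplex.hom_ext hX fun i x hx => ?_) x
    rw [LinearMap.comp_apply, hX.sign_spec _ _ hx, LinearMap.neg_apply]
    by_cases hi : i = 1
    · rw [if_neg (by subst hi; decide), map_neg]
    · have := hX.δ₁_deg i hi x hx
      split_ifs <;> simp [this]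
  ε_e := by
    rw [hX.sign_spec (-2) _ (hX.δ₂_deg ⟨1, rfl⟩), if_pos (by decide)]
  δ_pow k := by
    have h : ∀ k : ℕ, (X.v ^ k) (X.δ₂ 1) ∈ X.grading (-2 - 2 * k) := fun k => by
      induction k with
      | zero => exact hX.δ₂_deg ⟨1, rfl⟩
      | succ k ih =>
        rw [pow_succ', show (-2 - 2 * (k + 1 : ℕ) : ℤ) = -2 - 2 * k - 2 by push_cast; ring]
        exact hX.v_deg _ ⟨_, ih, rfl⟩
    exact hX.δ₁_deg _ (by omega) _ (h k)

theorem exists_polynomial_of_natBdd (f : ↥(NatBdd R R)) : ∃ p : R[X], ∀ i, p.coeff i = f.1 i := by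
  obtain ⟨N, hN⟩ := f.2
  refine ⟨∑ i ∈ Finset.range (N + 1), monomial i (f.1 i), fun i => ?_⟩
  simp only [finsetSum_coeff, coeff_monomial, Finset.sum_ite_eq', Finset.mem_range]
  split_ifs with h
  · rfl
  · exact (hN i (by omega)).symm

theorem exists_natBdd_of_polynomial (p : R[X]) : ∃ f : ↥(NatBdd R R), ∀ i, p.coeff i = f.1 i :=
  ⟨⟨p.coeff, p.natDegree, fun _ => coeff_eq_zero_of_natDegree_lt⟩, fun _ => rfl⟩

theorem sumV_eq_aeval (X : SComplexData R) (f : ↥(NatBdd R R)) (p : R[X])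
    (h : ∀ i, p.coeff i = f.1 i) : X.sumV f = aeval X.v p (X.δ₂ 1) := by
  have hs : ∀ i, (X.v ^ i) (X.δ₂ (f.1 i)) = p.coeff i • (X.v ^ i) (X.δ₂ 1) := fun i => by
    rw [h, ← map_smul, ← map_smul, smul_eq_mul, mul_one]
  simp only [sumV, hs, aeval_eq_sum_range, LinearMap.sum_apply, LinearMap.smul_apply]
  refine finsum_eq_sum_of_support_subset _ fun i hi => ?_
  rw [Finset.mem_coe, Finset.mem_range, Nat.lt_succ_iff]
  by_contra hlt
  exact hi (by simp [coeff_eq_zero_of_natDegree_lt (not_le.1 hlt)])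

theorem coeff_laurent_eq_iota (X : SComplexData R) (m : X.Tot) (f : ↥(NatBdd R R)) (p : R[X])
    (h : ∀ i, p.coeff i = f.1 i) (n : ℤ) :
    (laurent X.v X.δ₁ (m, p)).coeff (-n) = (X.iota (m, f)).1 n := by
  rw [coeff_laurent]
  simp only [iota, Left.neg_pos_iff, Int.natAbs_neg, h]
  split_ifs
  · rfl
  · rw [show n.natAbs = n.toNat by omega]

theorem degEq_iota_iff (X : SComplexData R) (m : X.Tot) (f : ↥(NatBdd R R)) (p : R[X])
    (h : ∀ i, p.coeff i = f.1 i) (n : ℤ) :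
    DegEq (X.iota (m, f)) n ↔
      laurent X.v X.δ₁ (m, p) ≠ 0 ∧ (laurent X.v X.δ₁ (m, p)).order = -n := by
  rw [order_eq_iff, DegEq, coeff_laurent_eq_iota X m f p h]
  refine and_congr_right fun _ => ⟨fun H k hk => ?_, fun H k hk => ?_⟩
  · rw [← neg_neg k, coeff_laurent_eq_iota X m f p h]
    exact H _ (by omega)
  · rw [← coeff_laurent_eq_iota X m f p h]
    exact H _ (by omega)

theorem mem_degSet_iff (X : SComplexData R) (n : ℤ) :
    n ∈ X.degSet ↔ HasDeg X.d X.v X.δ₁ (X.δ₂ 1) n := by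
  constructor
  · rintro ⟨_, ⟨⟨m, f⟩, hz, rfl⟩, hn⟩
    obtain ⟨p, hp⟩ := exists_polynomial_of_natBdd f
    refine ⟨(m, p), ?_, (degEq_iota_iff X m f p hp n).1 hn⟩
    rw [bdry_mk, ← sumV_eq_aeval X f p hp]
    exact congrArg Prod.fst hz
  · rintro ⟨⟨m, p⟩, hz, hn⟩
    obtain ⟨f, hp⟩ := exists_natBdd_of_polynomial p
    refine ⟨_, ⟨(m, f), ?_, rfl⟩, (degEq_iota_iff X m f p hp n).2 hn⟩
    rw [bdry_mk, ← sumV_eq_aeval X f p hp] at hz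
    exact Prod.ext hz rfl

theorem hInv_eq_neg [IsDomain R] {X : SComplexData R} (h : CommRel X.d X.v X.δ₁ (X.δ₂ 1)) {n : ℤ}
    (hn : IsMinDeg X.d X.v X.δ₁ (X.δ₂ 1) n) : X.hInv = -n := by
  have hX : X.degSet = {k | HasDeg X.d X.v X.δ₁ (X.δ₂ 1) k} := Set.ext (mem_degSet_iff X)
  rw [hInv, hX, (hn.isLeast h).csInf_eq]

variable (A B : SComplexData R)

theorem tensorS_v : (tensorS A B).v = tenV A.v A.δ₁ (A.δ₂ 1) B.v :=
  LinearMap.ext fun _ => rfl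

theorem tensorS_d : (tensorS A B).d =
    tenD A.d A.v A.sign A.δ₁ (A.δ₂ 1) B.d B.v B.δ₁ (B.δ₂ 1) :=
  LinearMap.ext fun _ => rfl

theorem tensorS_δ₁ : (tensorS A B).δ₁ = tenδ A.δ₁ B.δ₁ := rfl

theorem tensorS_δ₂ : (tensorS A B).δ₂ 1 = tenE R (A.δ₂ 1) (B.δ₂ 1) := rfl

end Link

end Froyshov

open SComplexData in
/-- **Statement 5.** The Frøyshov invariant is additive under tensor products of
S-complexes over an integral domain: `h(C̃ ⊗ C̃') = h(C̃) + h(C̃')`. -/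
theorem statement5 {R : Type u} [CommRing R] [IsDomain R]
    (A B : SComplexData R) (hA : A.IsSComplex) (hB : B.IsSComplex) :
    (tensorS A B).hInv = A.hInv + B.hInv := by
  have := hA.finite
  have := hB.finite
  have rA := Froyshov.IsSComplex.signedRel hA
  have rB := Froyshov.IsSComplex.signedRel hB
  obtain ⟨n, hn⟩ := Froyshov.exists_isMinDeg rA.comm
  obtain ⟨m, hm⟩ := Froyshov.exists_isMinDeg rB.comm
  have hc : Froyshov.CommRel (tensorS A B).d (tensorS A B).v (tensorS A B).δ₁
      ((tensorS A B).δ₂ 1) := by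
    rw [Froyshov.tensorS_d, Froyshov.tensorS_v, Froyshov.tensorS_δ₁, Froyshov.tensorS_δ₂]
    exact Froyshov.tenD_commRel rA rB.comm
  have ht : Froyshov.IsMinDeg (tensorS A B).d (tensorS A B).v (tensorS A B).δ₁
      ((tensorS A B).δ₂ 1) (n + m) := by
    rw [Froyshov.tensorS_d, Froyshov.tensorS_v, Froyshov.tensorS_δ₁, Froyshov.tensorS_δ₂]
    exact hn.tensor rA rB hm
  rw [Froyshov.hInv_eq_neg hc ht, Froyshov.hInv_eq_neg rA.comm hn, Froyshov.hInv_eq_neg rB.comm hm,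
    neg_add]
end
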